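/- Suppose K contains a closed Euclidean ball of radius 1 and has diameter d. Then for every measurable S ⊆ K with 0 < π_K(S) < 1, the conductance of the hit-and-run kernel satisfies φ(S) := (∫_S P(u, K∖S) dπ_K(u)) / min{π_K(S), π_K(K∖S)} ≥ 1/(2^{24}·n·d). -/

import Mathlib

section Part1
open MeasureTheory Set Filter Topology
open scoped ENNReal

namespace HR

/-- One-dimensional Brunn-Minkowski. -/
lemma bm1 {A B C : Set ℝ} (hA : MeasurableSet A) (hB : MeasurableSet B)
    (hAne : A.Nonempty) (hBne : B.Nonempty)
    (h : ∀ a ∈ A, ∀ b ∈ B, a + b ∈ C) : volume A + volume B ≤ volume C := by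
  -- compact case
  have key : ∀ A' ⊆ A, ∀ B' ⊆ B, IsCompact A' → IsCompact B' → A'.Nonempty → B'.Nonempty →
      volume A' + volume B' ≤ volume C := by
    intro A' hA' B' hB' cA cB nA nB
    obtain ⟨m, hmB, hm⟩ := cB.exists_isLeast nB
    obtain ⟨M, hMA, hM⟩ := cA.exists_isGreatest nA
    have h1 : volume ((fun x => x + m) '' A') = volume A' := by
      rw [image_add_right]; simp
    have h2 : volume ((fun x => M + x) '' B') = volume B' := by
      rw [image_add_left]; simp
    have h3 : volume ((fun x => M + x) '' B' \ {M + m}) = volume B' := by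
      rw [← h2]; exact measure_sdiff_null (by simp)
    rw [← h1, ← h3, ← measure_union]
    · apply measure_mono
      rintro x (⟨a, ha, rfl⟩ | ⟨⟨b, hb, rfl⟩, _⟩)
      · exact h a (hA' ha) m (hB' hmB)
      · exact h M (hA' hMA) b (hB' hb)
    · rw [Set.disjoint_left]
      rintro x ⟨a, ha, rfl⟩ ⟨⟨b, hb, hab⟩, hne⟩
      have h4 := hM ha
      have h5 := hm hb
      apply hne
      simp only [mem_singleton_iff]
      simp only at hab
      linarith
    · exact ((cB.image (continuous_const.add continuous_id)).measurableSet).diff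
        (measurableSet_singleton _)
  have key2 : ∀ A' ⊆ A, ∀ B' ⊆ B, IsCompact A' → IsCompact B' →
      volume A' + volume B' ≤ volume C := by
    intro A' hA' B' hB' cA cB
    obtain ⟨a, ha⟩ := hAne
    obtain ⟨b, hb⟩ := hBne
    refine le_trans ?_ (key (A' ∪ {a}) ?_ (B' ∪ {b}) ?_ ?_ ?_ ?_ ?_)
    · gcongr <;> exact subset_union_left
    · exact union_subset hA' (by simpa using ha)
    · exact union_subset hB' (by simpa using hb)
    · exact cA.union isCompact_singleton
    · exact cB.union isCompact_singleton
    · exact ⟨a, by simp⟩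
    · exact ⟨b, by simp⟩
  by_cases zA : volume A = 0
  · obtain ⟨a, ha⟩ := hAne
    rw [zA, zero_add]
    calc volume B = volume ((fun x => a + x) '' B) := by rw [image_add_left]; simp
      _ ≤ _ := measure_mono (by rintro x ⟨b, hb, rfl⟩; exact h a ha b hb)
  by_cases zB : volume B = 0
  · obtain ⟨a, ha⟩ := hBne
    rw [zB, add_zero]
    calc volume A = volume ((fun x => x + a) '' A) := by rw [image_add_right]; simp
      _ ≤ _ := measure_mono (by rintro x ⟨b, hb, rfl⟩; exact h b hb a ha)
  by_contra! hlt
  obtain ⟨a, ha, b, hb, hab⟩ := ENNReal.exists_lt_add_of_lt_add hlt zA zB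
  obtain ⟨A', hA', cA, h1⟩ := hA.exists_lt_isCompact ha
  obtain ⟨B', hB', cB, h2⟩ := hB.exists_lt_isCompact hb
  exact absurd ((add_le_add h1.le h2.le).trans (key2 A' hA' B' hB' cA cB)) hab.not_ge

lemma layer {f : ℝ → ℝ≥0∞} (hf : Measurable f) (h1 : ∀ x, f x ≤ 1) :
    ∫⁻ x, f x = ∫⁻ l in Ioo (0:ℝ) 1, volume {x | ENNReal.ofReal l < f x} := by
  have e : ∀ x, f x = ENNReal.ofReal (f x).toReal := fun x =>
    (ENNReal.ofReal_toReal (ne_top_of_le_ne_top ENNReal.one_ne_top (h1 x))).symm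
  have h2 := lintegral_eq_lintegral_meas_lt (volume : Measure ℝ) (f := fun x => (f x).toReal)
    (ae_of_all _ fun x => ENNReal.toReal_nonneg) hf.ennreal_toReal.aemeasurable
  have h3 : ∀ l, 0 < l → {x | l < (f x).toReal} = {x | ENNReal.ofReal l < f x} := by
    intro l hl
    ext x
    simp only [mem_ofPred_eq]
    exact (ENNReal.ofReal_lt_iff_lt_toReal hl.le
      (ne_top_of_le_ne_top ENNReal.one_ne_top (h1 x))).symm
  rw [show ∫⁻ x, f x = ∫⁻ x, ENNReal.ofReal (f x).toReal from lintegral_congr e, h2]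
  rw [← lintegral_indicator measurableSet_Ioi, ← lintegral_indicator measurableSet_Ioo]
  apply lintegral_congr
  intro l
  by_cases hl : 0 < l
  · by_cases hl1 : l < 1
    · rw [indicator_of_mem (show l ∈ Ioi 0 from hl), indicator_of_mem (show l ∈ Ioo 0 1 from ⟨hl, hl1⟩),
        h3 l hl]
    · rw [indicator_of_mem (show l ∈ Ioi 0 from hl), indicator_of_notMem (fun h => hl1 h.2), h3 l hl]
      convert measure_empty (μ := (volume : Measure ℝ))
      ext x
      simp only [mem_ofPred_eq, mem_empty_iff_false, iff_false, not_lt]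
      refine (h1 x).trans ?_
      rw [ENNReal.one_le_ofReal]; linarith
  · rw [indicator_of_notMem (fun h => hl (mem_Ioi.1 h)), indicator_of_notMem (fun h => hl h.1)]

lemma amgm {t : ℝ} (h0 : 0 < t) (h1 : t < 1) (a b : ℝ≥0∞) :
    a ^ (1 - t) * b ^ t ≤ ENNReal.ofReal (1 - t) * a + ENNReal.ofReal t * b := by
  by_cases ha : a = ∞
  · rw [ha, ENNReal.mul_top]; simp
    simp; linarith
  by_cases hb : b = ∞
  · rw [hb, ENNReal.mul_top]; simp
    simp; linarith
  lift a to NNReal using ha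
  lift b to NNReal using hb
  have := NNReal.geom_mean_le_arith_mean2_weighted (Real.toNNReal (1-t)) (Real.toNNReal t) a b
    (by rw [← Real.toNNReal_add] <;> [simp; linarith; linarith])
  rw [Real.coe_toNNReal _ (by linarith), Real.coe_toNNReal _ h0.le] at this
  rw [← ENNReal.coe_rpow_of_nonneg _ (by linarith), ← ENNReal.coe_rpow_of_nonneg _ h0.le]
  unfold ENNReal.ofReal
  exact_mod_cast this

/-- One-dimensional Prekopa-Leindler, normalized. -/
lemma pl1_aux {t : ℝ} (h0 : 0 < t) (h1 : t < 1) {f g h : ℝ → ℝ≥0∞}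
    (hf : Measurable f) (hg : Measurable g) (hh : Measurable h)
    (H : ∀ x y, f x ^ (1 - t) * g y ^ t ≤ h ((1 - t) * x + t * y))
    (hf1 : ⨆ x, f x = 1) (hg1 : ⨆ x, g x = 1) :
    (∫⁻ x, f x) ^ (1 - t) * (∫⁻ x, g x) ^ t ≤ ∫⁻ x, h x := by
  have f1 : ∀ x, f x ≤ 1 := fun x => hf1 ▸ le_iSup f x
  have g1 : ∀ x, g x ≤ 1 := fun x => hg1 ▸ le_iSup g x
  refine (amgm h0 h1 _ _).trans ?_
  have hh' : ∫⁻ x, min (h x) 1 ≤ ∫⁻ x, h x := lintegral_mono fun x => min_le_left _ _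
  refine le_trans ?_ hh'
  rw [layer hf f1, layer hg g1, layer (hh.min measurable_const) (fun x => min_le_right _ _)]
  rw [← lintegral_const_mul' _ _ ENNReal.ofReal_ne_top, ← lintegral_const_mul' _ _ ENNReal.ofReal_ne_top]
  rw [← lintegral_add_left']
  · apply setLIntegral_mono' measurableSet_Ioo
    intro l hl
    have ne1 : ∃ x, ENNReal.ofReal l < f x := by
      have : ENNReal.ofReal l < ⨆ x, f x := by
        rw [hf1, ENNReal.ofReal_lt_one]; exact hl.2
      exact lt_iSup_iff.1 this
    have ne2 : ∃ x, ENNReal.ofReal l < g x := by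
      have : ENNReal.ofReal l < ⨆ x, g x := by
        rw [hg1, ENNReal.ofReal_lt_one]; exact hl.2
      exact lt_iSup_iff.1 this
    have e1 : ENNReal.ofReal (1-t) * volume {x | ENNReal.ofReal l < f x}
        = volume ((fun x => (1-t)⁻¹ * x) ⁻¹' {x | ENNReal.ofReal l < f x}) := by
      rw [Real.volume_preimage_mul_left (inv_ne_zero (by linarith)), inv_inv, abs_of_pos (by linarith)]
    have e2 : ENNReal.ofReal t * volume {x | ENNReal.ofReal l < g x}
        = volume ((fun x => t⁻¹ * x) ⁻¹' {x | ENNReal.ofReal l < g x}) := by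
      rw [Real.volume_preimage_mul_left (inv_ne_zero h0.ne'), inv_inv, abs_of_pos h0]
    rw [e1, e2]
    apply bm1
    · exact (measurableSet_lt measurable_const hf).preimage (measurable_const_mul _)
    · exact (measurableSet_lt measurable_const hg).preimage (measurable_const_mul _)
    · obtain ⟨x, hx⟩ := ne1
      refine ⟨(1-t) * x, ?_⟩
      simp only [mem_preimage, mem_ofPred_eq]
      rwa [inv_mul_cancel_left₀ (by linarith)]
    · obtain ⟨x, hx⟩ := ne2
      refine ⟨t * x, ?_⟩
      simp only [mem_preimage, mem_ofPred_eq]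
      rwa [inv_mul_cancel_left₀ h0.ne']
    · intro a ha b hb
      simp only [mem_preimage, mem_ofPred_eq] at ha hb ⊢
      rw [lt_min_iff]
      refine ⟨?_, by rw [ENNReal.ofReal_lt_one]; exact hl.2⟩
      have := H ((1-t)⁻¹ * a) (t⁻¹ * b)
      rw [mul_inv_cancel_left₀ (by linarith), mul_inv_cancel_left₀ h0.ne'] at this
      refine lt_of_lt_of_le ?_ this
      have p0 : ENNReal.ofReal l ≠ 0 := by simpa using hl.1
      calc ENNReal.ofReal l = ENNReal.ofReal l ^ (1-t) * ENNReal.ofReal l ^ t := by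
            rw [← ENNReal.rpow_add _ _ p0 ENNReal.ofReal_ne_top]; simp
        _ < _ := ENNReal.mul_lt_mul (ENNReal.rpow_lt_rpow ha (by linarith)) (ENNReal.rpow_lt_rpow hb h0)
  · apply AEMeasurable.const_mul
    apply Measurable.aemeasurable
    apply Antitone.measurable
    intro a b hab
    exact measure_mono fun x (hx : _ < _) => lt_of_le_of_lt (ENNReal.ofReal_le_ofReal hab) hx

lemma pl1_bdd {t : ℝ} (h0 : 0 < t) (h1 : t < 1) {f g h : ℝ → ℝ≥0∞}
    (hf : Measurable f) (hg : Measurable g) (hh : Measurable h)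
    (H : ∀ x y, f x ^ (1 - t) * g y ^ t ≤ h ((1 - t) * x + t * y))
    (hf1 : ⨆ x, f x ≠ ∞) (hg1 : ⨆ x, g x ≠ ∞) :
    (∫⁻ x, f x) ^ (1 - t) * (∫⁻ x, g x) ^ t ≤ ∫⁻ x, h x := by
  set M := ⨆ x, f x with hM
  set N := ⨆ x, g x with hN
  by_cases M0 : M = 0
  · have : ∫⁻ x, f x = 0 := by
      rw [lintegral_eq_zero_iff hf]
      exact ae_of_all _ fun x => le_antisymm ((le_iSup f x).trans_eq M0) zero_le
    rw [this, ENNReal.zero_rpow_of_pos (by linarith)]; simp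
  by_cases N0 : N = 0
  · have : ∫⁻ x, g x = 0 := by
      rw [lintegral_eq_zero_iff hg]
      exact ae_of_all _ fun x => le_antisymm ((le_iSup g x).trans_eq N0) zero_le
    rw [this, ENNReal.zero_rpow_of_pos h0]; simp
  have h1t : 0 ≤ 1 - t := by linarith
  set C := M ^ (1-t) * N ^ t with hC
  have C0 : C ≠ 0 := by
    simp only [hC, ne_eq, mul_eq_zero, ENNReal.rpow_eq_zero_iff, not_or]
    simp [M0, N0, hf1, hg1]
  have Ct : C ≠ ∞ := ENNReal.mul_ne_top (ENNReal.rpow_ne_top_of_nonneg h1t hf1)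
    (ENNReal.rpow_ne_top_of_nonneg h0.le hg1)
  have Cinv : C⁻¹ = (M⁻¹) ^ (1-t) * (N⁻¹) ^ t := by
    rw [hC, ENNReal.mul_inv, ENNReal.inv_rpow, ENNReal.inv_rpow]
    · right; exact ENNReal.rpow_ne_top_of_nonneg h0.le hg1
    · left; exact ENNReal.rpow_ne_top_of_nonneg h1t hf1
  have := pl1_aux h0 h1 (f := fun x => M⁻¹ * f x) (g := fun x => N⁻¹ * g x)
    (h := fun x => C⁻¹ * h x) (hf.const_mul _) (hg.const_mul _) (hh.const_mul _) ?_ ?_ ?_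
  · rw [lintegral_const_mul _ hf, lintegral_const_mul _ hg, lintegral_const_mul _ hh,
      ENNReal.mul_rpow_of_nonneg _ _ h1t, ENNReal.mul_rpow_of_nonneg _ _ h0.le,
      mul_mul_mul_comm, ← Cinv] at this
    exact (ENNReal.mul_le_mul_iff_right (ENNReal.inv_ne_zero.2 Ct) (ENNReal.inv_ne_top.2 C0)).1 this
  · intro x y
    rw [ENNReal.mul_rpow_of_nonneg _ _ h1t, ENNReal.mul_rpow_of_nonneg _ _ h0.le,
      mul_mul_mul_comm, ← Cinv]
    gcongr
    exact H x y
  · rw [← ENNReal.mul_iSup, ← hM, ENNReal.inv_mul_cancel M0 hf1]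
  · rw [← ENNReal.mul_iSup, ← hN, ENNReal.inv_mul_cancel N0 hg1]

lemma pl1 {t : ℝ} (h0 : 0 < t) (h1 : t < 1) {f g h : ℝ → ℝ≥0∞}
    (hf : Measurable f) (hg : Measurable g) (hh : Measurable h)
    (H : ∀ x y, f x ^ (1 - t) * g y ^ t ≤ h ((1 - t) * x + t * y)) :
    (∫⁻ x, f x) ^ (1 - t) * (∫⁻ x, g x) ^ t ≤ ∫⁻ x, h x := by
  have h1t : 0 < 1 - t := by linarith
  have key : ∀ k : ℕ, (∫⁻ x, min (f x) k) ^ (1 - t) * (∫⁻ x, min (g x) k) ^ t ≤ ∫⁻ x, h x := by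
    intro k
    apply pl1_bdd h0 h1 (hf.min measurable_const) (hg.min measurable_const) hh
    · intro x y
      refine le_trans ?_ (H x y)
      gcongr
      · exact min_le_left _ _
      · exact min_le_left _ _
    · exact ne_top_of_le_ne_top (ENNReal.natCast_ne_top k) (iSup_le fun x => min_le_right _ _)
    · exact ne_top_of_le_ne_top (ENNReal.natCast_ne_top k) (iSup_le fun x => min_le_right _ _)
  have lim : ∀ f : ℝ → ℝ≥0∞, Measurable f →
      Tendsto (fun k : ℕ => ∫⁻ x, min (f x) k) atTop (𝓝 (∫⁻ x, f x)) := by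
    intro f hf
    apply lintegral_tendsto_of_tendsto_of_monotone
    · intro k; exact (hf.min measurable_const).aemeasurable
    · refine ae_of_all _ fun x i j hij => ?_
      simp only
      gcongr
    · refine ae_of_all _ fun x => ?_
      have : Tendsto (fun k : ℕ => min (f x) (k : ℝ≥0∞)) atTop (𝓝 (min (f x) ∞)) :=
        tendsto_const_nhds.min ENNReal.tendsto_nat_nhds_top
      simpa using this
  by_cases F0 : ∫⁻ x, f x = 0
  · rw [F0, ENNReal.zero_rpow_of_pos (by linarith)]; simp
  by_cases G0 : ∫⁻ x, g x = 0
  · rw [G0, ENNReal.zero_rpow_of_pos h0]; simp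
  have T := ENNReal.Tendsto.mul ((ENNReal.continuous_rpow_const (y := 1-t)).continuousAt.tendsto.comp (lim f hf))
    (Or.inl (by simp [F0, h1t.not_gt, ENNReal.rpow_eq_zero_iff, h1t]))
    ((ENNReal.continuous_rpow_const (y := t)).continuousAt.tendsto.comp (lim g hg))
    (Or.inl (by simp [G0, h0.not_gt, ENNReal.rpow_eq_zero_iff, h0]))
  exact le_of_tendsto' T key

lemma pln {t : ℝ} (h0 : 0 < t) (h1 : t < 1) : ∀ (n : ℕ) {f g h : (Fin n → ℝ) → ℝ≥0∞}
    (_ : Measurable f) (_ : Measurable g) (_ : Measurable h)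
    (_ : ∀ x y, f x ^ (1 - t) * g y ^ t ≤ h ((1 - t) • x + t • y)),
    (∫⁻ x, f x) ^ (1 - t) * (∫⁻ x, g x) ^ t ≤ ∫⁻ x, h x := by
  intro n
  induction n with
  | zero =>
    intro f g h _ _ _ H
    have e : ∀ f : (Fin 0 → ℝ) → ℝ≥0∞, ∫⁻ x, f x = f 0 := by
      intro f
      rw [lintegral_unique]
      have : (volume : Measure (Fin 0 → ℝ)) univ = 1 := by
        rw [volume_pi, Measure.pi_univ]; simp
      rw [this, mul_one]
      congr 1
      exact Subsingleton.elim _ _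
    rw [e, e, e]
    have := H 0 0
    simpa using this
  | succ n ih =>
    intro f g h hf hg hh H
    have mp := (volume_preserving_piFinSuccAbove (fun _ : Fin (n+1) => ℝ) 0).symm
    have e : ∀ f : (Fin (n+1) → ℝ) → ℝ≥0∞, Measurable f →
        ∫⁻ x, f x = ∫⁻ a : ℝ, ∫⁻ x : Fin n → ℝ, f (Fin.cons a x) := by
      intro f hf
      rw [← mp.lintegral_comp hf, Measure.volume_eq_prod, lintegral_prod]
      · apply lintegral_congr; intro a; apply lintegral_congr; intro x
        congr 1
        simp [MeasurableEquiv.piFinSuccAbove, Fin.insertNthEquiv]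
      · exact (hf.comp mp.measurable).aemeasurable
    have mc : Measurable (fun p : ℝ × (Fin n → ℝ) => (Fin.cons p.1 p.2 : Fin (n+1) → ℝ)) := by
      rw [measurable_pi_iff]
      intro i
      refine Fin.cases ?_ (fun i => ?_) i
      · simpa using measurable_fst
      · simp only [Fin.cons_succ]
        exact (measurable_pi_apply i).comp measurable_snd
    rw [e f hf, e g hg, e h hh]
    apply pl1 h0 h1
    · exact (hf.comp mc).lintegral_prod_right'
    · exact (hg.comp mc).lintegral_prod_right'
    · exact (hh.comp mc).lintegral_prod_right'
    · intro a b
      apply ih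
      · exact hf.comp (mc.comp (measurable_const.prodMk measurable_id))
      · exact hg.comp (mc.comp (measurable_const.prodMk measurable_id))
      · exact hh.comp (mc.comp (measurable_const.prodMk measurable_id))
      · intro x y
        convert H (Fin.cons a x) (Fin.cons b y) using 2
        ext i
        refine Fin.cases ?_ (fun i => ?_) i <;> simp

/-- Brunn-Minkowski, multiplicative form, in Euclidean space. -/
lemma bm {n : ℕ} {t : ℝ} (h0 : 0 ≤ t) (h1 : t ≤ 1) {A B C : Set (EuclideanSpace ℝ (Fin n))}
    (hA : MeasurableSet A) (hB : MeasurableSet B) (hC : MeasurableSet C)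
    (nA : A.Nonempty) (nB : B.Nonempty)
    (H : ∀ x ∈ A, ∀ y ∈ B, (1 - t) • x + t • y ∈ C) :
    volume A ^ (1 - t) * volume B ^ t ≤ volume C := by
  rcases h0.eq_or_lt with rfl | h0
  · simp
    obtain ⟨b, hb⟩ := nB
    exact measure_mono fun x hx => by simpa using H x hx b hb
  rcases h1.eq_or_lt with rfl | h1
  · simp
    obtain ⟨b, hb⟩ := nA
    exact measure_mono fun x hx => by simpa using H b hb x hx
  have mp := (EuclideanSpace.volume_preserving_symm_measurableEquiv_toLp (Fin n)).symm
  have e : ∀ A : Set (EuclideanSpace ℝ (Fin n)), MeasurableSet A →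
      volume A = ∫⁻ x : Fin n → ℝ, A.indicator 1 (WithLp.toLp 2 x) := by
    intro A hA
    rw [← lintegral_indicator_one hA, ← mp.lintegral_comp (measurable_one.indicator hA)]
    rfl
  have mt : Measurable (fun x : Fin n → ℝ => WithLp.toLp 2 x) := mp.measurable
  rw [e A hA, e B hB, e C hC]
  apply pln h0 h1
  · exact (measurable_one.indicator hA).comp mt
  · exact (measurable_one.indicator hB).comp mt
  · exact (measurable_one.indicator hC).comp mt
  · intro x y
    by_cases hx : WithLp.toLp 2 x ∈ A
    · by_cases hy : WithLp.toLp 2 y ∈ B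
      · have := H _ hx _ hy
        rw [indicator_of_mem hx, indicator_of_mem hy]
        have e : WithLp.toLp 2 ((1 - t) • x + t • y) = (1 - t) • WithLp.toLp 2 x + t • WithLp.toLp 2 y := by
          simp
        rw [e, indicator_of_mem this]; simp
      · rw [indicator_of_notMem hy, ENNReal.zero_rpow_of_pos h0]; simp
    · rw [indicator_of_notMem hx, ENNReal.zero_rpow_of_pos (by linarith)]; simp
end HR

end Part1

section Part2
open MeasureTheory Set Filter Topology
open scoped ENNReal

namespace HR

section iso
variable {n : ℕ}

/-- Points reachable from `A` moving towards the deep set `{σ ≤ s}`, with time `τ`. -/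
def reach (K A : Set (EuclideanSpace ℝ (Fin n))) (s : EuclideanSpace ℝ (Fin n) → ℝ) (σ τ : ℝ) :
    Set (EuclideanSpace ℝ (Fin n)) :=
  {w | ∃ x ∈ A, ∃ y ∈ K, σ ≤ s y ∧ ∃ θ : ℝ, 0 ≤ θ ∧ θ ≤ 1 ∧ w = (1 - θ) • x + θ • y ∧ θ ≤ τ * s w}

structure IsoData (K A : Set (EuclideanSpace ℝ (Fin n))) (s : EuclideanSpace ℝ (Fin n) → ℝ)
    (σ : ℝ) : Prop where
  cK : IsCompact K
  nonneg : ∀ x ∈ K, 0 ≤ s x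
  bdd : ∃ b, ∀ x ∈ K, s x ≤ b
  meas : Measurable s
  closed : IsClosed {p : EuclideanSpace ℝ (Fin n) × ℝ | p.1 ∈ K ∧ p.2 ≤ s p.1}
  conc : ConcaveOn ℝ K s
  σpos : 0 < σ
  cA : IsCompact A
  AK : A ⊆ K
  pos : ∀ x ∈ A, 0 < s x
  gne : ∃ y ∈ K, σ ≤ s y

variable {K A : Set (EuclideanSpace ℝ (Fin n))} {s : EuclideanSpace ℝ (Fin n) → ℝ} {σ : ℝ}

namespace IsoData

lemma reach_sub (h : IsoData K A s σ) (τ : ℝ) : reach K A s σ τ ⊆ K := by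
  rintro w ⟨x, hx, y, hy, -, θ, h0, h1, rfl, -⟩
  exact h.conc.1 (h.AK hx) hy (by linarith) h0 (by ring)

lemma reach_mono (h : IsoData K A s σ) {τ τ' : ℝ} (hτ : τ ≤ τ') :
    reach K A s σ τ ⊆ reach K A s σ τ' := by
  intro w hw
  have hwK := h.reach_sub _ hw
  obtain ⟨x, hx, y, hy, hσ, θ, h0, h1, e, h2⟩ := hw
  refine ⟨x, hx, y, hy, hσ, θ, h0, h1, e, h2.trans ?_⟩
  exact mul_le_mul_of_nonneg_right hτ (h.nonneg w hwK)

lemma sub_reach (h : IsoData K A s σ) {τ : ℝ} (hτ : 0 ≤ τ) : A ⊆ reach K A s σ τ := by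
  intro x hx
  obtain ⟨y, hy, hσ⟩ := h.gne
  exact ⟨x, hx, y, hy, hσ, 0, le_rfl, zero_le_one, by simp, mul_nonneg hτ (h.nonneg x (h.AK hx))⟩

lemma reach_zero (_ : IsoData K A s σ) : reach K A s σ 0 ⊆ A := by
  rintro w ⟨x, hx, y, hy, -, θ, h0, h1, e, h2⟩
  have : θ = 0 := by linarith
  subst this
  simp at e
  rwa [e]

lemma convG (h : IsoData K A s σ) : Convex ℝ {x ∈ K | σ ≤ s x} := h.conc.convex_ge σ

lemma closedGe (h : IsoData K A s σ) (a : ℝ) : IsClosed {x ∈ K | a ≤ s x} := by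
  have : Continuous fun x : EuclideanSpace ℝ (Fin n) => (x, a) := by fun_prop
  exact h.closed.preimage this

lemma compGe (h : IsoData K A s σ) (a : ℝ) : IsCompact {x ∈ K | a ≤ s x} :=
  h.cK.of_isClosed_subset (h.closedGe a) fun _ hx => hx.1

lemma reach_comp (h : IsoData K A s σ) {τ φ : ℝ} {w y : EuclideanSpace ℝ (Fin n)}
    (hτ : 0 ≤ τ) (hw : w ∈ reach K A s σ τ) (hy : y ∈ K) (hyσ : σ ≤ s y) (hφ0 : 0 ≤ φ) (hφ1 : φ ≤ 1)
    (hp : 0 < s ((1 - φ) • w + φ • y)) :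
    (1 - φ) • w + φ • y ∈ reach K A s σ (τ + φ / s ((1 - φ) • w + φ • y)) := by
  have hwK := h.reach_sub _ hw
  obtain ⟨x, hx, z, hz, hσ, θ, h0, h1, e, h2⟩ := hw
  set w' := (1 - φ) • w + φ • y with hw'
  have hs : (1 - φ) * s w ≤ s w' := by
    have := h.conc.2 hwK hy (sub_nonneg.2 hφ1) hφ0 (by ring)
    simp only [smul_eq_mul] at this
    have h3 := mul_nonneg hφ0 (h.nonneg y hy)
    linarith
  have hb : θ * (1 - φ) + φ ≤ (τ + φ / s w') * s w' := by
    rw [add_mul, div_mul_cancel₀ _ hp.ne']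
    have : θ * (1 - φ) ≤ (τ * s w) * (1 - φ) := mul_le_mul_of_nonneg_right h2 (by linarith)
    nlinarith
  have hn : 0 ≤ θ * (1 - φ) := mul_nonneg h0 (by linarith)
  rcases (add_nonneg hn hφ0).eq_or_lt with h4 | h4
  · have e1 : φ = 0 := by linarith
    have e2 : θ = 0 := by rw [e1] at h4; linarith
    refine ⟨x, hx, y, hy, hyσ, 0, le_rfl, zero_le_one, ?_, by linarith⟩
    rw [hw', e1, e, e2]; simp
  · set θ' := θ * (1 - φ) + φ with hθ'
    have hG := h.convG (x := z) ⟨hz, hσ⟩ (y := y) ⟨hy, hyσ⟩ (a := θ * (1-φ) / θ') (b := φ / θ')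
      (by positivity) (by positivity) (by rw [← add_div]; exact div_self h4.ne')
    refine ⟨x, hx, _, hG.1, hG.2, θ', h4.le, by nlinarith, ?_, hb⟩
    rw [smul_add, smul_smul, smul_smul, mul_div_cancel₀ _ h4.ne', mul_div_cancel₀ _ h4.ne', hw', e, hθ']
    module

/-- joint compactness of the reach relation -/
lemma closedRel (h : IsoData K A s σ) (M : ℝ) :
    IsCompact {p : EuclideanSpace ℝ (Fin n) × ℝ | 0 ≤ p.2 ∧ p.2 ≤ M ∧ p.1 ∈ reach K A s σ p.2} := by
  obtain ⟨b, hb⟩ := h.bdd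
  let E := EuclideanSpace ℝ (Fin n)
  let Z : Set (E × E × ℝ × ℝ × ℝ) := A ×ˢ {x ∈ K | σ ≤ s x} ×ˢ Icc (0:ℝ) 1 ×ˢ Icc (0:ℝ) b ×ˢ Icc (0:ℝ) M
  have cZ : IsCompact Z := h.cA.prod ((h.compGe σ).prod (isCompact_Icc.prod (isCompact_Icc.prod isCompact_Icc)))
  let ψ : E × E × ℝ × ℝ × ℝ → E := fun q => (1 - q.2.2.1) • q.1 + q.2.2.1 • q.2.1
  have cψ : Continuous ψ := by fun_prop
  let Z' := Z ∩ ({q | q.2.2.1 ≤ q.2.2.2.2 * q.2.2.2.1} ∩ (fun q => (ψ q, q.2.2.2.1)) ⁻¹' {p : E × ℝ | p.1 ∈ K ∧ p.2 ≤ s p.1})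
  have cZ' : IsCompact Z' := by
    apply cZ.inter_right
    apply IsClosed.inter
    · exact isClosed_le (by fun_prop) (by fun_prop)
    · exact h.closed.preimage (by fun_prop)
  have c2 : Continuous fun q : E × E × ℝ × ℝ × ℝ => (ψ q, q.2.2.2.2) := by fun_prop
  convert cZ'.image c2 using 1
  ext ⟨w, τ⟩
  constructor
  · rintro ⟨h0, hM, hw⟩
    have hwK := h.reach_sub _ hw
    obtain ⟨x, hx, y, hy, hσ, θ, t0, t1, e, h2⟩ := hw
    simp only at e h2
    refine ⟨(x, y, θ, s w, τ), ⟨⟨hx, ⟨hy, hσ⟩, ⟨t0, t1⟩, ⟨h.nonneg w hwK, hb w hwK⟩, ⟨h0, hM⟩⟩, h2, ?_⟩, ?_⟩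
    · simp only [ψ, mem_preimage, mem_ofPred_eq, ← e]
      exact ⟨hwK, le_rfl⟩
    · simp only [ψ, ← e]
  · rintro ⟨⟨x, y, θ, b', τ'⟩, ⟨⟨hx, ⟨hy, hσ⟩, ⟨t0, t1⟩, ⟨b0, b1⟩, ⟨h0, hM⟩⟩, h2, h3⟩, h4⟩
    simp only [ψ, Prod.mk.injEq] at h4 h0 hM
    obtain ⟨e1, e2⟩ := h4
    subst e2
    simp only [ψ, mem_preimage, mem_ofPred_eq, e1] at h3 h2
    refine ⟨h0, hM, x, hx, y, hy, hσ, θ, t0, t1, e1.symm, h2.trans ?_⟩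
    exact mul_le_mul_of_nonneg_left h3.2 h0

lemma reach_compact (h : IsoData K A s σ) {τ : ℝ} (hτ : 0 ≤ τ) : IsCompact (reach K A s σ τ) := by
  convert ((h.closedRel τ).inter_right (isClosed_singleton.preimage continuous_snd :
    IsClosed (Prod.snd ⁻¹' {τ}))).image continuous_fst using 1
  ext w
  constructor
  · intro hw
    exact ⟨(w, τ), ⟨⟨hτ, le_rfl, hw⟩, rfl⟩, rfl⟩
  · rintro ⟨⟨w', τ'⟩, ⟨⟨_, _, h3⟩, h4⟩, h5⟩
    simp at h4 h5 h3
    subst h4; subst h5; exact h3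

end IsoData
end iso
end HR

end Part2

section Part3
open MeasureTheory Set Filter Topology
open scoped ENNReal

namespace HR

section iso
variable {n : ℕ}
variable {K A : Set (EuclideanSpace ℝ (Fin n))} {s : EuclideanSpace ℝ (Fin n) → ℝ} {σ : ℝ}

namespace IsoData

/-- Brunn-Minkowski for compact sets. -/
lemma bm_compact {B G : Set (EuclideanSpace ℝ (Fin n))} (cB : IsCompact B) (cG : IsCompact G)
    (nB : B.Nonempty) (nG : G.Nonempty) {δ : ℝ} (h0 : 0 ≤ δ) (h1 : δ ≤ 1) :
    ∃ C : Set (EuclideanSpace ℝ (Fin n)), IsCompact C ∧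
      (∀ w ∈ C, ∃ x ∈ B, ∃ y ∈ G, w = (1 - δ) • x + δ • y) ∧
      volume B ^ (1 - δ) * volume G ^ δ ≤ volume C := by
  refine ⟨(fun p : EuclideanSpace ℝ (Fin n) × EuclideanSpace ℝ (Fin n) =>
    (1 - δ) • p.1 + δ • p.2) '' (B ×ˢ G), ?_, ?_, ?_⟩
  · exact (cB.prod cG).image (by fun_prop)
  · rintro w ⟨⟨x, y⟩, ⟨hx, hy⟩, rfl⟩
    exact ⟨x, hx, y, hy, rfl⟩
  · apply bm h0 h1 cB.measurableSet cG.measurableSet _ nB nG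
    · intro x hx y hy
      exact ⟨(x, y), ⟨hx, hy⟩, rfl⟩
    · exact ((cB.prod cG).image (by fun_prop)).measurableSet

lemma step (h : IsoData K A s σ) {τ a η : ℝ} (hτ : 0 ≤ τ) (ha : 0 < a) (haσ : a ≤ σ / 2)
    (hη : 0 ≤ η) (hησ : η * σ ≤ 1)
    (hG : volume (reach K A s σ τ) ≤ volume {x ∈ K | σ ≤ s x}) :
    volume (A ∩ {x | a ≤ s x ∧ s x < (1 + η * σ / 2) * a}) ≤
      volume {w | w ∈ K ∧ (1 + η * σ / 2) * a ≤ s w ∧ w ∉ reach K A s σ τ ∧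
        w ∈ reach K A s σ (τ + η * a / s w)} := by
  set R := reach K A s σ τ with hR
  set ρ := 1 + η * σ / 2 with hρ
  have hσ := h.σpos
  set B := R ∩ {x ∈ K | a ≤ s x} with hB
  have cR : IsCompact R := h.reach_compact hτ
  have cB : IsCompact B := cR.inter_right (h.closedGe a)
  have cB' : IsCompact (R ∩ {x ∈ K | ρ * a ≤ s x}) := cR.inter_right (h.closedGe _)
  have AR : A ⊆ R := h.sub_reach hτ
  by_cases nB : B.Nonempty
  swap
  · have : A ∩ {x | a ≤ s x ∧ s x < ρ * a} = ∅ := by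
      rw [Set.eq_empty_iff_forall_notMem]
      rintro x ⟨hx, h1, h2⟩
      exact nB ⟨x, AR hx, h.AK hx, h1⟩
    rw [this]; simp
  have hηa : η * a ≤ 1 := by nlinarith
  have hηa0 : 0 ≤ η * a := by positivity
  obtain ⟨C, cC, hC, hvol⟩ := bm_compact cB (h.compGe σ) nB h.gne hηa0 hηa
  have hBC : volume B ≤ volume C := by
    refine le_trans ?_ hvol
    have hBG : volume B ≤ volume {x ∈ K | σ ≤ s x} := (measure_mono inter_subset_left).trans hG
    by_cases zB : volume B = 0
    · rw [zB]; exact zero_le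
    calc volume B = volume B ^ (1 - η * a) * volume B ^ (η * a) := by
          rw [← ENNReal.rpow_add _ _ zB cB.measure_ne_top]; simp
      _ ≤ _ := by gcongr
  have hCs : ∀ w ∈ C, w ∈ K ∧ ρ * a ≤ s w ∧ w ∈ reach K A s σ (τ + η * a / s w) := by
    intro w hw
    obtain ⟨x, hx, y, hy, rfl⟩ := hC w hw
    have h1 := h.conc.2 hx.2.1 hy.1 (sub_nonneg.2 hηa) hηa0 (by ring)
    simp only [smul_eq_mul] at h1
    have h2 : ρ * a ≤ s ((1 - η * a) • x + (η * a) • y) := by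
      refine le_trans ?_ h1
      have h3 : (1 - η * a) * a ≤ (1 - η * a) * s x := mul_le_mul_of_nonneg_left hx.2.2 (by linarith)
      have h4 : η * a * σ ≤ η * a * s y := mul_le_mul_of_nonneg_left hy.2 hηa0
      have h5 : η * a * a ≤ η * a * (σ / 2) := mul_le_mul_of_nonneg_left haσ hηa0
      rw [hρ]; nlinarith
    have hpos : 0 < s ((1 - η * a) • x + (η * a) • y) := lt_of_lt_of_le (by positivity) h2
    exact ⟨h.conc.1 hx.2.1 hy.1 (by linarith) hηa0 (by ring), h2,
      h.reach_comp hτ hx.1 hy.1 hy.2 hηa0 hηa hpos⟩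
  have hρ1 : 1 ≤ ρ := by rw [hρ]; have : 0 ≤ η * σ / 2 := by positivity
                         linarith
  -- volume bookkeeping
  have v1 : volume B = volume (R ∩ {x ∈ K | ρ * a ≤ s x}) + volume (B \ (R ∩ {x ∈ K | ρ * a ≤ s x})) := by
    rw [← measure_inter_add_diff B cB'.measurableSet]
    congr 2
    rw [inter_eq_right]
    rintro x ⟨hx, hxK, h1⟩
    refine ⟨hx, hxK, le_trans ?_ h1⟩
    nlinarith
  have v2 : volume C ≤ volume (R ∩ {x ∈ K | ρ * a ≤ s x}) + volume (C \ R) := by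
    rw [← measure_inter_add_diff C cR.measurableSet]
    refine add_le_add (measure_mono ?_) le_rfl
    rintro w ⟨hw, hwR⟩
    exact ⟨hwR, (hCs w hw).1, (hCs w hw).2.1⟩
  have v3 : volume (B \ (R ∩ {x ∈ K | ρ * a ≤ s x})) ≤ volume (C \ R) := by
    have := v1 ▸ (hBC.trans v2)
    exact (ENNReal.add_le_add_iff_left cB'.measure_ne_top).1 this
  refine le_trans (measure_mono ?_) (v3.trans (measure_mono ?_))
  · rintro x ⟨hx, h1, h2⟩
    exact ⟨⟨AR hx, h.AK hx, h1⟩, fun h3 => absurd h3.2.2 (not_le.2 h2)⟩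
  · rintro w ⟨hw, hwR⟩
    exact ⟨(hCs w hw).1, (hCs w hw).2.1, hwR, (hCs w hw).2.2⟩

lemma telescope (c : ℕ → ℝ) (hc : Antitone c) (hc0 : ∀ k, 0 ≤ c k) (x : ℝ) (hx : 0 ≤ x) (N : ℕ) :
    ∑ k ∈ Finset.range N, (if c k ≤ x then c k - c (k+1) else 0) ≤ x := by
  have : ∀ N, ∑ k ∈ Finset.range N, (if c k ≤ x then c k - c (k+1) else 0) ≤ max 0 (x - c N) := by
    intro N
    induction N with
    | zero => simp
    | succ N ih =>
      rw [Finset.sum_range_succ]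
      split_ifs with h
      · have : max 0 (x - c N) = x - c N := max_eq_right (by linarith)
        rw [this] at ih
        exact le_max_of_le_right (by linarith)
      · have : max 0 (x - c N) = 0 := max_eq_left (by linarith)
        rw [this] at ih
        exact le_max_of_le_left (by linarith)
  refine (this N).trans (max_le hx ?_)
  linarith [hc0 N]

lemma step_int (h : IsoData K A s σ) {a η : ℝ} (ha : 0 < a) (haσ : a ≤ σ / 2)
    (hη : 0 ≤ η) (hησ : η * σ ≤ 1)
    (hG : volume (reach K A s σ η) ≤ volume {x ∈ K | σ ≤ s x}) :
    ENNReal.ofReal η * volume (A ∩ {x | a ≤ s x ∧ s x < (1 + η * σ / 2) * a}) ≤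
      ∫⁻ w in reach K A s σ (2 * η) \ A,
        ENNReal.ofReal (if (1 + η * σ / 2) * a ≤ s w then η * a / s w else 0) := by
  set ρ := 1 + η * σ / 2 with hρ
  have hσ := h.σpos
  have hρ1 : 1 ≤ ρ := by rw [hρ]; have : 0 ≤ η * σ / 2 := by positivity
                         linarith
  let U : Set (ℝ × EuclideanSpace ℝ (Fin n)) :=
    {p | p.1 ∈ Icc (0:ℝ) η ∧ p.2 ∈ K ∧ ρ * a ≤ s p.2 ∧ p.2 ∉ reach K A s σ p.1 ∧
        p.2 ∈ reach K A s σ (p.1 + η * a / s p.2)}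
  have hle : ∀ w, ρ * a ≤ s w → 0 < s w ∧ η * a / s w ≤ η ∧ 0 ≤ η * a / s w := by
    intro w hw
    have h1 : a ≤ s w := le_trans (by nlinarith) hw
    have h2 : 0 < s w := by linarith
    refine ⟨h2, ?_, by positivity⟩
    rw [div_le_iff₀ h2]; nlinarith
  have mΓ : MeasurableSet {p : EuclideanSpace ℝ (Fin n) × ℝ | 0 ≤ p.2 ∧ p.2 ≤ 2 * η ∧ p.1 ∈ reach K A s σ p.2} :=
    (h.closedRel (2 * η)).measurableSet
  have mU : MeasurableSet U := by
    have e : U = (Prod.fst ⁻¹' (Icc (0:ℝ) η)) ∩ (Prod.snd ⁻¹' {x ∈ K | ρ * a ≤ s x}) ∩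
      ((fun p => (p.2, p.1)) ⁻¹' {p : EuclideanSpace ℝ (Fin n) × ℝ | 0 ≤ p.2 ∧ p.2 ≤ 2 * η ∧ p.1 ∈ reach K A s σ p.2})ᶜ ∩
      ((fun p => (p.2, p.1 + η * a / s p.2)) ⁻¹' {p : EuclideanSpace ℝ (Fin n) × ℝ | 0 ≤ p.2 ∧ p.2 ≤ 2 * η ∧ p.1 ∈ reach K A s σ p.2}) := by
      ext ⟨τ, w⟩
      simp only [U, mem_ofPred_eq, mem_inter_iff, mem_preimage, mem_compl_iff, mem_Icc]
      constructor
      · rintro ⟨⟨h1, h2⟩, h3, h4, h5, h6⟩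
        obtain ⟨h7, h8, h9⟩ := hle w h4
        exact ⟨⟨⟨⟨h1, h2⟩, h3, h4⟩, fun h => h5 h.2.2⟩, by linarith, by linarith, h6⟩
      · rintro ⟨⟨⟨⟨h1, h2⟩, h3, h4⟩, h5⟩, h6⟩
        exact ⟨⟨h1, h2⟩, h3, h4, fun h => h5 ⟨h1, by linarith, h⟩, h6.2.2⟩
    rw [e]
    refine MeasurableSet.inter (MeasurableSet.inter (MeasurableSet.inter ?_ ?_) ?_) ?_
    · exact measurableSet_Icc.preimage measurable_fst
    · exact (h.closedGe _).measurableSet.preimage measurable_snd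
    · exact (mΓ.preimage (measurable_snd.prodMk measurable_fst)).compl
    · exact mΓ.preimage (measurable_snd.prodMk (measurable_fst.add
        (measurable_const.div (h.meas.comp measurable_snd))))
  -- lower bound
  have L : ENNReal.ofReal η * volume (A ∩ {x | a ≤ s x ∧ s x < ρ * a}) ≤ (volume.prod volume) U := by
    rw [Measure.prod_apply mU]
    calc _ = ∫⁻ τ in Icc (0:ℝ) η, volume (A ∩ {x | a ≤ s x ∧ s x < ρ * a}) := by
          rw [setLIntegral_const, Real.volume_Icc, mul_comm]; simp
      _ ≤ ∫⁻ τ in Icc (0:ℝ) η, volume (Prod.mk τ ⁻¹' U) := by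
          apply setLIntegral_mono' measurableSet_Icc
          intro τ hτ
          refine (h.step hτ.1 ha haσ hη hησ ?_).trans (measure_mono ?_)
          · exact (measure_mono (h.reach_mono hτ.2)).trans hG
          · rintro w ⟨h1, h2, h3, h4⟩
            exact ⟨hτ, h1, h2, h3, h4⟩
      _ ≤ _ := setLIntegral_le_lintegral _ _
  refine L.trans ?_
  rw [Measure.prod_apply_symm mU, ← lintegral_indicator (((h.reach_compact (by positivity)).measurableSet).diff h.cA.measurableSet)]
  apply lintegral_mono
  intro w
  by_cases hne : ((fun x => (x, w)) ⁻¹' U).Nonempty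
  swap
  · rw [Set.not_nonempty_iff_eq_empty] at hne
    simp only [hne, measure_empty]; exact zero_le
  obtain ⟨τ₀, ⟨h1, h2⟩, h3, h4, h5, h6⟩ := hne
  simp only at h1 h2 h3 h4 h5 h6
  obtain ⟨h7, h8, h9⟩ := hle w h4
  have hwD : w ∈ reach K A s σ (2 * η) \ A := by
    refine ⟨h.reach_mono (by linarith) h6, fun hA => h5 (h.sub_reach h1 hA)⟩
  rw [indicator_of_mem hwD, if_pos h4]
  -- the section lies in an interval
  have sub : ∀ τ ∈ ((fun x => (x, w)) ⁻¹' U), ∀ τ' ∈ ((fun x => (x, w)) ⁻¹' U), τ' ≤ τ + η * a / s w := by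
    rintro τ ⟨⟨g1, g2⟩, g3, g4, g5, g6⟩ τ' ⟨⟨k1, k2⟩, k3, k4, k5, k6⟩
    by_contra! hlt
    exact k5 (h.reach_mono hlt.le g6)
  set V := (fun x => (x, w)) ⁻¹' U with hV
  have bV : BddBelow V := ⟨0, fun τ hτ => hτ.1.1⟩
  have nV : V.Nonempty := ⟨τ₀, ⟨h1, h2⟩, h3, h4, h5, h6⟩
  have : V ⊆ Icc (sInf V) (sInf V + η * a / s w) := by
    intro τ' hτ'
    refine ⟨csInf_le bV hτ', ?_⟩
    have : τ' - η * a / s w ≤ sInf V := le_csInf nV fun τ hτ => by linarith [sub τ hτ τ' hτ']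
    linarith
  refine (measure_mono this).trans ?_
  rw [Real.volume_Icc]; simp

lemma low (h : IsoData K A s σ) {η : ℝ} (hη : 0 < η) (hησ : η * σ ≤ 1)
    (hG : volume (reach K A s σ η) ≤ volume {x ∈ K | σ ≤ s x}) :
    ENNReal.ofReal η * volume (A ∩ {x | s x < σ / 2}) ≤
      ENNReal.ofReal (2 / σ) * volume (reach K A s σ (2 * η) \ A) := by
  set ρ := 1 + η * σ / 2 with hρ
  have hσ := h.σpos
  have hρ1 : 1 < ρ := by rw [hρ]; have : 0 < η * σ / 2 := by positivity
                         linarith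
  have hρ0 : 0 < ρ := by linarith
  let c : ℕ → ℝ := fun k => σ / 2 * (ρ⁻¹) ^ k
  have cpos : ∀ k, 0 < c k := fun k => by positivity
  have csucc : ∀ k, ρ * c (k+1) = c k := by
    intro k; simp only [c, pow_succ]; field_simp
  have canti : Antitone c := antitone_nat_of_succ_le fun k => by
    have := csucc k; nlinarith [cpos (k+1)]
  have cle : ∀ k, c k ≤ σ / 2 := fun k => by
    have := canti (Nat.zero_le k); simpa [c] using this
  have clim : Tendsto c atTop (𝓝 0) := by
    have := (tendsto_pow_atTop_nhds_zero_of_lt_one (inv_nonneg.2 hρ0.le) (inv_lt_one_of_one_lt₀ hρ1)).const_mul (σ/2)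
    simpa [c] using this
  have cover : A ∩ {x | s x < σ / 2} ⊆ ⋃ k, A ∩ {x | c (k+1) ≤ s x ∧ s x < ρ * c (k+1)} := by
    rintro x ⟨hx, hx2⟩
    have ex : ∃ k, c k ≤ s x := by
      have := (clim.eventually (gt_mem_nhds (h.pos x hx))).exists
      obtain ⟨k, hk⟩ := this
      exact ⟨k, hk.le⟩
    classical
    have hf := Nat.find_spec ex
    have hm := fun m => Nat.find_min ex (m := m)
    cases hk : Nat.find ex with
    | zero =>
      rw [hk] at hf
      simp [c] at hf
      exact absurd hx2 (not_lt.2 hf)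
    | succ k =>
      rw [hk] at hf
      have := hm k (by omega)
      rw [not_le, ← csucc k] at this
      exact mem_iUnion.2 ⟨k, hx, hf, this⟩
  have D : MeasurableSet (reach K A s σ (2 * η) \ A) :=
    ((h.reach_compact (by positivity)).measurableSet).diff h.cA.measurableSet
  calc ENNReal.ofReal η * volume (A ∩ {x | s x < σ / 2})
      ≤ ENNReal.ofReal η * ∑' k, volume (A ∩ {x | c (k+1) ≤ s x ∧ s x < ρ * c (k+1)}) := by
        gcongr
        exact (measure_mono cover).trans (measure_iUnion_le _)
    _ = ∑' k, ENNReal.ofReal η * volume (A ∩ {x | c (k+1) ≤ s x ∧ s x < ρ * c (k+1)}) := by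
        rw [ENNReal.tsum_mul_left]
    _ ≤ ∑' k, ∫⁻ w in reach K A s σ (2 * η) \ A,
        ENNReal.ofReal (if ρ * c (k+1) ≤ s w then η * c (k+1) / s w else 0) := by
        apply ENNReal.tsum_le_tsum
        intro k
        exact h.step_int (cpos _) (cle _) hη.le hησ hG
    _ = ∫⁻ w in reach K A s σ (2 * η) \ A, ∑' k,
        ENNReal.ofReal (if ρ * c (k+1) ≤ s w then η * c (k+1) / s w else 0) := by
        rw [lintegral_tsum]
        intro k
        apply Measurable.aemeasurable
        apply Measurable.ennreal_ofReal
        apply Measurable.ite (measurableSet_le measurable_const h.meas)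
        · exact measurable_const.div h.meas
        · exact measurable_const
    _ ≤ ∫⁻ w in reach K A s σ (2 * η) \ A, ENNReal.ofReal (2 / σ) := by
        apply setLIntegral_mono' D
        intro w hw
        have hw0 := h.nonneg w (h.reach_sub _ hw.1)
        apply ENNReal.tsum_le_of_sum_range_le
        intro N
        rcases hw0.eq_or_lt with h0 | h0
        · rw [← h0]; simp
        rw [← ENNReal.ofReal_sum_of_nonneg]
        · apply ENNReal.ofReal_le_ofReal
          have key := telescope c canti (fun k => (cpos k).le) (s w) hw0 N
          have : ∀ k, (if ρ * c (k+1) ≤ s w then η * c (k+1) / s w else 0)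
              = (2 / σ / s w) * (if c k ≤ s w then c k - c (k+1) else 0) := by
            intro k
            rw [csucc]
            split_ifs
            · rw [← csucc k, hρ]; field_simp; ring
            · simp
          rw [Finset.sum_congr rfl fun k _ => this k, ← Finset.mul_sum]
          calc _ ≤ (2 / σ / s w) * s w := by gcongr
            _ = _ := by field_simp
        · intro k _
          split_ifs
          · have := cpos (k+1); positivity
          · exact le_rfl
    _ = _ := by rw [setLIntegral_const]

lemma high (h : IsoData K A s σ) {T : ℝ} (hT : 0 < T) (hTσ : T * σ ≤ 1)
    (hG : 3 / 2 * volume A ≤ volume {x ∈ K | σ ≤ s x}) :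
    ENNReal.ofReal (T * σ / 6) * volume (A ∩ {x | σ / 2 ≤ s x}) ≤ volume (reach K A s σ T \ A) := by
  have hσ := h.σpos
  set B := A ∩ {x ∈ K | σ / 2 ≤ s x} with hB
  have eB : A ∩ {x | σ / 2 ≤ s x} = B := by
    ext x; exact ⟨fun hx => ⟨hx.1, h.AK hx.1, hx.2⟩, fun hx => ⟨hx.1, hx.2.2⟩⟩
  rw [eB]
  have cB : IsCompact B := h.cA.inter_right (h.closedGe _)
  by_cases zB : volume B = 0
  · rw [zB]; simp
  have nB : B.Nonempty := nonempty_of_measure_ne_zero zB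
  set δ := T * σ / 2 with hδ
  have δ0 : 0 < δ := by positivity
  have δ1 : δ ≤ 1 := by rw [hδ]; linarith
  obtain ⟨C, cC, hC, hvol⟩ := bm_compact cB (h.compGe σ) nB h.gne δ0.le δ1
  have hCs : ∀ w ∈ C, w ∈ K ∧ σ / 2 ≤ s w ∧ w ∈ reach K A s σ T := by
    intro w hw
    obtain ⟨x, hx, y, hy, rfl⟩ := hC w hw
    have h1 := h.conc.2 hx.2.1 hy.1 (sub_nonneg.2 δ1) δ0.le (by ring)
    simp only [smul_eq_mul] at h1
    have h2 : σ / 2 ≤ s ((1 - δ) • x + δ • y) := by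
      refine le_trans ?_ h1
      have h3 : (1 - δ) * (σ/2) ≤ (1 - δ) * s x := mul_le_mul_of_nonneg_left hx.2.2 (by linarith)
      have h4 : δ * σ ≤ δ * s y := mul_le_mul_of_nonneg_left hy.2 δ0.le
      nlinarith
    refine ⟨h.conc.1 hx.2.1 hy.1 (by linarith) δ0.le (by ring), h2, x, hx.1, y, hy.1, hy.2, δ, δ0.le, δ1, rfl, ?_⟩
    rw [hδ]; nlinarith
  have hBt : volume B ≠ ∞ := cB.measure_ne_top
  have h32 : (1 : ℝ) + δ / 3 ≤ (3/2 : ℝ) ^ δ := by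
    rw [Real.rpow_def_of_pos (by norm_num)]
    have h1 := Real.one_sub_inv_le_log_of_pos (show (0:ℝ) < 3/2 by norm_num)
    have h2 := Real.add_one_le_exp (Real.log (3/2) * δ)
    have h3 : (1/3) * δ ≤ Real.log (3/2) * δ := by gcongr; linarith
    linarith
  have hBC : volume B + ENNReal.ofReal (δ / 3) * volume B ≤ volume C := by
    refine le_trans ?_ hvol
    have hBG : ENNReal.ofReal (3/2) * volume B ≤ volume {x ∈ K | σ ≤ s x} := by
      refine le_trans ?_ hG
      have : ENNReal.ofReal (3/2) = 3/2 := by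
        rw [ENNReal.ofReal_div_of_pos (by norm_num)]; simp
      rw [this]
      gcongr
      exact inter_subset_left
    calc volume B + ENNReal.ofReal (δ / 3) * volume B
        = ENNReal.ofReal (1 + δ / 3) * volume B := by
          rw [ENNReal.ofReal_add zero_le_one (by positivity), add_mul]; simp
      _ ≤ ENNReal.ofReal ((3/2) ^ δ) * volume B := by gcongr
      _ = volume B ^ (1 - δ) * (ENNReal.ofReal (3/2) * volume B) ^ δ := by
          rw [ENNReal.mul_rpow_of_nonneg _ _ δ0.le, ENNReal.ofReal_rpow_of_pos (by norm_num), mul_left_comm,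
            ← ENNReal.rpow_add _ _ zB hBt]
          simp
      _ ≤ _ := by gcongr
  have v2 : volume C ≤ volume B + volume (reach K A s σ T \ A) := by
    rw [← measure_inter_add_diff C h.cA.measurableSet]
    gcongr
    · rintro w ⟨hw, hwA⟩
      exact ⟨hwA, (hCs w hw).1, (hCs w hw).2.1⟩
    · intro w hw
      exact (hCs w hw).2.2
  have := (ENNReal.add_le_add_iff_left hBt).1 (hBC.trans v2)
  rw [hδ] at this
  convert this using 3
  ring

/-- The isoperimetric inequality. -/
theorem iso (h : IsoData K A s σ) {T : ℝ} (hT : 0 < T) (hTσ : T * σ ≤ 1)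
    (hA : 2 * volume.real A ≤ volume.real K)
    (hG : 3 / 4 * volume.real K ≤ volume.real {x ∈ K | σ ≤ s x}) :
    T * σ / 12 * volume.real A ≤ volume.real (reach K A s σ T \ A) := by
  have hσ := h.σpos
  have fA : volume A ≠ ∞ := h.cA.measure_ne_top
  have fG : volume {x ∈ K | σ ≤ s x} ≠ ∞ := (h.compGe σ).measure_ne_top
  have fR : volume (reach K A s σ T) ≠ ∞ := (h.reach_compact hT.le).measure_ne_top
  have fD : volume (reach K A s σ T \ A) ≠ ∞ := ne_top_of_le_ne_top fR (measure_mono sdiff_subset)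
  have nA : 0 ≤ volume.real A := measureReal_nonneg
  have split : volume.real A = volume.real (A ∩ {x | s x < σ/2}) + volume.real (A ∩ {x | σ/2 ≤ s x}) := by
    rw [← measureReal_inter_add_diff (s := A) (measurableSet_lt h.meas measurable_const : MeasurableSet {x | s x < σ/2}) fA]
    congr 2
    ext x; simp
  by_cases hc : volume.real A ≤ 2 * volume.real (A ∩ {x | σ/2 ≤ s x})
  · have := h.high hT hTσ (by
      rw [← ENNReal.toReal_le_toReal (ENNReal.mul_ne_top (by finiteness) fA) fG, ENNReal.toReal_mul]
      have e : (3/2 : ℝ≥0∞).toReal = 3/2 := by simp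
      rw [e]
      change 3/2 * volume.real A ≤ volume.real _
      linarith)
    have := ENNReal.toReal_mono fD this
    rw [ENNReal.toReal_mul, ENNReal.toReal_ofReal (by positivity)] at this
    change T * σ / 6 * volume.real _ ≤ volume.real _ at this
    refine le_trans ?_ this
    have : 0 < T * σ := by positivity
    nlinarith
  · by_cases hR : volume (reach K A s σ (T/2)) ≤ volume {x ∈ K | σ ≤ s x}
    · have := h.low (η := T/2) (by positivity) (by nlinarith) hR
      rw [show 2 * (T/2) = T by ring] at this
      have := ENNReal.toReal_mono (ENNReal.mul_ne_top (by simp) fD) this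
      rw [ENNReal.toReal_mul, ENNReal.toReal_mul, ENNReal.toReal_ofReal (by positivity), ENNReal.toReal_ofReal (by positivity)] at this
      change T / 2 * volume.real _ ≤ 2/σ * volume.real _ at this
      rw [div_mul_eq_mul_div 2 σ, le_div_iff₀ hσ] at this
      have p : 0 < T * σ := by positivity
      nlinarith
    · rw [not_le, ← ENNReal.toReal_lt_toReal fG (h.reach_compact (by positivity)).measure_ne_top] at hR
      have h1 : volume.real (reach K A s σ (T/2)) ≤ volume.real (reach K A s σ T) :=
        measureReal_mono (h.reach_mono (by linarith)) fR
      have h2 := measureReal_sdiff_add_inter (μ := volume) (s := reach K A s σ T) h.cA.measurableSet fR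
      have h3 : reach K A s σ T ∩ A = A := inter_eq_right.2 (h.sub_reach hT.le)
      rw [h3] at h2
      change volume.real _ < volume.real _ at hR
      nlinarith
end IsoData
end iso
end HR

end Part3

section Part4
open MeasureTheory Set Filter Topology
open scoped ENNReal

namespace HR

section sfun
variable {n : ℕ}

/-- the set of `u` in the unit ball with `x + t u ∈ K` -/
def sect (K : Set (EuclideanSpace ℝ (Fin n))) (x : EuclideanSpace ℝ (Fin n)) (t : ℝ) :
    Set (EuclideanSpace ℝ (Fin n)) :=
  {u | u ∈ Metric.closedBall 0 1 ∧ x + t • u ∈ K}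

/-- `t` is a good scale at `x`. -/
def good (K : Set (EuclideanSpace ℝ (Fin n))) (x : EuclideanSpace ℝ (Fin n)) (t : ℝ) : Prop :=
  ENNReal.ofReal (3/4) * volume (Metric.closedBall (0 : EuclideanSpace ℝ (Fin n)) 1) ≤
    volume (sect K x t) ∧ ∀ u : EuclideanSpace ℝ (Fin n), ‖u‖ ≤ 1 → x + (t / √n) • u ∈ K

lemma sect_compact {K : Set (EuclideanSpace ℝ (Fin n))} (hK : IsCompact K) (x t) :
    IsCompact (sect K x t) := by
  have : sect K x t = Metric.closedBall 0 1 ∩ (fun u => x + t • u) ⁻¹' K := rfl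
  rw [this]
  exact (isCompact_closedBall _ _).inter_right (hK.isClosed.preimage (by fun_prop))

lemma good_mem {K : Set (EuclideanSpace ℝ (Fin n))} {x t} (h : good K x t) : x ∈ K := by
  simpa using h.2 0 (by simp)

lemma good_zero {K : Set (EuclideanSpace ℝ (Fin n))} {x} (h : x ∈ K) : good K x 0 := by
  refine ⟨?_, fun u _ => by simpa using h⟩
  have : sect K x 0 = Metric.closedBall 0 1 := by
    ext u; simp [sect, h]
  rw [this]
  refine mul_le_of_le_one_left (zero_le) ?_
  rw [← ENNReal.ofReal_one]
  exact ENNReal.ofReal_le_ofReal (by norm_num)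

lemma good_closed {K : Set (EuclideanSpace ℝ (Fin n))} (hK : IsCompact K) :
    IsClosed {p : EuclideanSpace ℝ (Fin n) × ℝ | good K p.1 p.2} := by
  have e : {p : EuclideanSpace ℝ (Fin n) × ℝ | good K p.1 p.2} =
    {p | ENNReal.ofReal (3/4) * volume (Metric.closedBall (0 : EuclideanSpace ℝ (Fin n)) 1) ≤
    volume (sect K p.1 p.2)} ∩ ⋂ u : EuclideanSpace ℝ (Fin n), ⋂ _ : ‖u‖ ≤ 1,
      {p | p.1 + (p.2 / √n) • u ∈ K} := by
    ext p; simp [good]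
  rw [e]
  refine IsClosed.inter ?_ (isClosed_iInter fun u => isClosed_iInter fun _ =>
    hK.isClosed.preimage (f := fun p : EuclideanSpace ℝ (Fin n) × ℝ => p.1 + (p.2 / √n) • u) (by fun_prop))
  refine IsSeqClosed.isClosed ?_
  intro p q hp hpq
  simp only [mem_ofPred_eq] at hp ⊢
  by_contra hc
  push Not at hc
  obtain ⟨U, hUs, hUo, hU⟩ := (sect_compact hK q.1 q.2).exists_isOpen_lt_of_lt _ hc
  have : ∀ k, ∃ u ∈ Metric.closedBall (0 : EuclideanSpace ℝ (Fin n)) 1 ∩ Uᶜ,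
      (p k).1 + (p k).2 • u ∈ K := by
    intro k
    by_contra h1
    push Not at h1
    refine absurd ((hp k).trans (measure_mono ?_)) (not_le.2 hU)
    intro u hu
    by_contra h2
    exact h1 u ⟨hu.1, h2⟩ hu.2
  choose u hu hk using this
  obtain ⟨v, hv, φ, hφ, hlim⟩ := ((isCompact_closedBall (0 : EuclideanSpace ℝ (Fin n)) 1).inter_right
    hUo.isClosed_compl).tendsto_subseq hu
  refine hv.2 (hUs ⟨hv.1, ?_⟩)
  have hq := hpq.comp hφ.tendsto_atTop
  refine hK.isClosed.mem_of_tendsto (f := fun k => (p (φ k)).1 + (p (φ k)).2 • u (φ k)) (b := atTop) ?_ (Eventually.of_forall fun k => hk _)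
  exact ((continuous_fst.tendsto q).comp hq).add (((continuous_snd.tendsto q).comp hq).smul hlim)

lemma good_mono {K : Set (EuclideanSpace ℝ (Fin n))} (hc : Convex ℝ K) {x a b} (ha : 0 ≤ a)
    (hab : a ≤ b) (h : good K x b) : good K x a := by
  have hx := good_mem h
  rcases ha.eq_or_lt with rfl | ha
  · exact good_zero hx
  have hb := ha.trans_le hab
  have key : ∀ (c : ℝ) (u : EuclideanSpace ℝ (Fin n)), x + (b * c) • u ∈ K → x + (a * c) • u ∈ K := by
    intro c u hu
    have := hc hx hu (a := 1 - a / b) (b := a / b) (by rw [sub_nonneg, div_le_one hb]; exact hab)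
      (by positivity) (by ring)
    convert this using 1
    rw [smul_add, smul_smul, ← add_assoc, ← add_smul]
    have : a / b * (b * c) = a * c := by field_simp
    rw [this]; simp
  refine ⟨h.1.trans (measure_mono fun u hu => ⟨hu.1, by simpa using key 1 u (by simpa using hu.2)⟩), fun u hu => ?_⟩
  have := key (1 / √n) u
  simp only [mul_one_div] at this
  exact this (h.2 u hu)

lemma good_conv {K : Set (EuclideanSpace ℝ (Fin n))} (hK : IsCompact K) (hc : Convex ℝ K)
    {x y : EuclideanSpace ℝ (Fin n)} {a b l m : ℝ} (ha : 0 ≤ a) (hb : 0 ≤ b) (hl : 0 ≤ l)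
    (hm : 0 ≤ m) (hlm : l + m = 1) (h0 : good K x a) (h1 : good K y b) :
    good K (l • x + m • y) (l * a + m * b) := by
  have ht : 0 ≤ l * a + m * b := by positivity
  have hxy := hc (good_mem h0) (good_mem h1) hl hm hlm
  rcases ht.eq_or_lt with ht | ht
  · rw [← ht]; exact good_zero hxy
  set t := l * a + m * b with htd
  have hθ0 : 0 ≤ m * b / t := by positivity
  have hθ : 1 - m * b / t = l * a / t := by rw [htd] at ht ⊢; field_simp; ring
  have hθ1 : m * b / t ≤ 1 := by
    have : 0 ≤ l * a / t := by positivity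
    linarith
  set W := volume (Metric.closedBall (0 : EuclideanSpace ℝ (Fin n)) 1) with hW
  have W0 : W ≠ 0 := (Metric.measure_closedBall_pos _ _ one_pos).ne'
  have Wt : W ≠ ⊤ := (isCompact_closedBall _ _).measure_ne_top
  set c := ENNReal.ofReal (3/4) * W with hcd
  have c0 : c ≠ 0 := mul_ne_zero (by simp) W0
  have ct : c ≠ ⊤ := ENNReal.mul_ne_top (by simp) Wt
  refine ⟨?_, fun u hu => ?_⟩
  · have := bm hθ0 hθ1 (sect_compact hK x a).measurableSet (sect_compact hK y b).measurableSet
      (sect_compact hK (l • x + m • y) t).measurableSet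
      (nonempty_of_measure_ne_zero (μ := volume) ((pos_iff_ne_zero.2 c0).trans_le h0.1).ne')
      (nonempty_of_measure_ne_zero (μ := volume) ((pos_iff_ne_zero.2 c0).trans_le h1.1).ne') ?_
    · refine le_trans ?_ this
      calc c = c ^ (1 - m * b / t) * c ^ (m * b / t) := by
            rw [← ENNReal.rpow_add _ _ c0 ct]; simp
        _ ≤ _ := by
            gcongr
            · exact h0.1
            · exact h1.1
    · intro u hu v hv
      refine ⟨(convex_closedBall 0 1) hu.1 hv.1 (by linarith) hθ0 (by ring), ?_⟩
      have := hc hu.2 hv.2 hl hm hlm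
      convert this using 1
      rw [hθ]
      simp only [smul_add, smul_smul]
      rw [mul_div_cancel₀ _ ht.ne', mul_div_cancel₀ _ ht.ne']
      abel
  · have := hc (h0.2 u hu) (h1.2 u hu) hl hm hlm
    convert this using 1
    rw [htd]
    module

/-- the scale function -/
noncomputable def sf (K : Set (EuclideanSpace ℝ (Fin n))) (x : EuclideanSpace ℝ (Fin n)) : ℝ :=
  sSup {t | 0 ≤ t ∧ good K x t}

lemma good_bdd (hn : 2 ≤ n) {K : Set (EuclideanSpace ℝ (Fin n))} (hK : IsCompact K) {x t}
    (h0 : 0 ≤ t) (h : good K x t) : t ≤ √n * Metric.diam K := by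
  have : Nonempty (Fin n) := ⟨⟨0, by omega⟩⟩
  obtain ⟨u, hu⟩ := exists_norm_eq (EuclideanSpace ℝ (Fin n)) zero_le_one
  have := Metric.dist_le_diam_of_mem hK.isBounded (h.2 u hu.le) (good_mem h)
  have hs : 0 < √(n:ℝ) := by positivity
  rw [dist_self_add_left, norm_smul, hu, mul_one, Real.norm_of_nonneg (by positivity), div_le_iff₀ hs] at this
  linarith

lemma sf_nonneg (K : Set (EuclideanSpace ℝ (Fin n))) (x) : 0 ≤ sf K x :=
  Real.sSup_nonneg fun _ h => h.1

lemma sf_good (hn : 2 ≤ n) {K : Set (EuclideanSpace ℝ (Fin n))} (hK : IsCompact K) {x}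
    (hx : x ∈ K) : good K x (sf K x) := by
  have hcl : IsClosed {t : ℝ | 0 ≤ t ∧ good K x t} :=
    (isClosed_le continuous_const continuous_id).inter
      ((good_closed hK).preimage (f := fun t : ℝ => (x, t)) (by fun_prop))
  exact (hcl.csSup_mem ⟨0, le_rfl, good_zero hx⟩ ⟨_, fun t ht => good_bdd hn hK ht.1 ht.2⟩).2

lemma le_sf (hn : 2 ≤ n) {K : Set (EuclideanSpace ℝ (Fin n))} (hK : IsCompact K) {x t}
    (h0 : 0 ≤ t) (h : good K x t) : t ≤ sf K x :=
  le_csSup ⟨_, fun t ht => good_bdd hn hK ht.1 ht.2⟩ ⟨h0, h⟩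

lemma good_iff (hn : 2 ≤ n) {K : Set (EuclideanSpace ℝ (Fin n))} (hK : IsCompact K) (hc : Convex ℝ K) {x t}
    (hx : x ∈ K) (h0 : 0 ≤ t) : good K x t ↔ t ≤ sf K x :=
  ⟨le_sf hn hK h0, fun h => good_mono hc h0 h (sf_good hn hK hx)⟩

lemma sf_meas (hn : 2 ≤ n) {K : Set (EuclideanSpace ℝ (Fin n))} (hK : IsCompact K) (hc : Convex ℝ K) :
    Measurable (sf K) := by
  refine measurable_of_Ici fun a => ?_
  rcases le_or_gt a 0 with ha | ha
  · have : sf K ⁻¹' Ici a = univ := by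
      ext x; simpa using ha.trans (sf_nonneg K x)
    rw [this]; exact MeasurableSet.univ
  · have : sf K ⁻¹' Ici a = (fun x => (x, a)) ⁻¹' {p : EuclideanSpace ℝ (Fin n) × ℝ | good K p.1 p.2} := by
      ext x
      simp only [mem_preimage, mem_Ici, mem_ofPred_eq]
      constructor
      · intro h
        have hx : x ∈ K := by
          by_contra hx
          have : sf K x = 0 := by
            unfold sf
            convert Real.sSup_empty
            ext t; simp only [mem_ofPred_eq, mem_empty_iff_false, iff_false, not_and]
            exact fun _ h => hx (good_mem h)
          linarith
        exact (good_iff hn hK hc hx ha.le).2 h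
      · exact le_sf hn hK ha.le
    rw [this]
    exact ((good_closed hK).preimage (by fun_prop)).measurableSet

lemma sf_conc (hn : 2 ≤ n) {K : Set (EuclideanSpace ℝ (Fin n))} (hK : IsCompact K) (hc : Convex ℝ K) :
    ConcaveOn ℝ K (sf K) := by
  refine ⟨hc, fun x hx y hy l m hl hm hlm => ?_⟩
  have h1 := sf_nonneg K x
  have h2 := sf_nonneg K y
  exact le_sf hn hK (by positivity) (good_conv hK hc h1 h2 hl hm hlm (sf_good hn hK hx) (sf_good hn hK hy))

lemma sf_hyp (hn : 2 ≤ n) {K : Set (EuclideanSpace ℝ (Fin n))} (hK : IsCompact K) (hc : Convex ℝ K) :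
    IsClosed {p : EuclideanSpace ℝ (Fin n) × ℝ | p.1 ∈ K ∧ p.2 ≤ sf K p.1} := by
  have : {p : EuclideanSpace ℝ (Fin n) × ℝ | p.1 ∈ K ∧ p.2 ≤ sf K p.1} =
    (fun p : EuclideanSpace ℝ (Fin n) × ℝ => (p.1, max p.2 0)) ⁻¹' {p | good K p.1 p.2} := by
    ext p
    simp only [mem_preimage, mem_ofPred_eq]
    constructor
    · rintro ⟨h1, h2⟩
      exact (good_iff hn hK hc h1 (le_max_right _ _)).2 (max_le h2 (sf_nonneg _ _))
    · intro h
      exact ⟨good_mem h, (le_max_left _ _).trans (le_sf hn hK (le_max_right _ _) h)⟩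
  rw [this]
  exact (good_closed hK).preimage (by fun_prop)

lemma sf_pos (hn : 2 ≤ n) {K : Set (EuclideanSpace ℝ (Fin n))} (hK : IsCompact K)
    {x} (hx : x ∈ interior K) : 0 < sf K x := by
  obtain ⟨ε, hε, hb⟩ := Metric.isOpen_iff.1 isOpen_interior x hx
  have h2 : 0 < ε / 2 := by positivity
  have hb' : ∀ u : EuclideanSpace ℝ (Fin n), ‖u‖ ≤ ε / 2 → x + u ∈ K := fun u hu =>
    interior_subset (hb (by rw [Metric.mem_ball, dist_self_add_left]; linarith))
  refine h2.trans_le (le_sf hn hK h2.le ⟨?_, fun u hu => hb' _ ?_⟩)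
  · have : sect K x (ε / 2) = Metric.closedBall 0 1 := by
      ext u
      refine ⟨fun h => h.1, fun h => ⟨h, hb' _ ?_⟩⟩
      rw [norm_smul, Real.norm_of_nonneg h2.le]
      rw [mem_closedBall_zero_iff] at h
      nlinarith
    rw [this]
    refine mul_le_of_le_one_left (zero_le) ?_
    rw [← ENNReal.ofReal_one]
    exact ENNReal.ofReal_le_ofReal (by norm_num)
  · have hs : 1 ≤ √(n:ℝ) := by rw [Real.one_le_sqrt]; exact_mod_cast (by omega : 1 ≤ n)
    rw [norm_smul, Real.norm_of_nonneg (by positivity)]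
    have : ε / 2 / √n ≤ ε / 2 := div_le_self h2.le hs
    nlinarith [norm_nonneg u]

lemma isoData (hn : 2 ≤ n) {K A : Set (EuclideanSpace ℝ (Fin n))} (hK : IsCompact K) (hc : Convex ℝ K)
    (cA : IsCompact A) (AK : A ⊆ interior K) {σ : ℝ} (hσ : 0 < σ) (hg : ∃ y ∈ K, σ ≤ sf K y) :
    IsoData K A (sf K) σ where
  cK := hK
  nonneg x _ := sf_nonneg K x
  bdd := ⟨√n * Metric.diam K, fun x hx => good_bdd hn hK (sf_nonneg _ _) (sf_good hn hK hx)⟩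
  meas := sf_meas hn hK hc
  closed := sf_hyp hn hK hc
  conc := sf_conc hn hK hc
  σpos := hσ
  cA := cA
  AK := AK.trans interior_subset
  pos x hx := sf_pos hn hK (AK hx)
  gne := hg

end sfun
end HR

end Part4

section Part5
open MeasureTheory Set Filter Topology
open scoped ENNReal Pointwise

namespace HR

section deep
variable {n : ℕ}

lemma exists_rot (e e' : EuclideanSpace ℝ (Fin n)) (he : ‖e‖ = 1) (he' : ‖e'‖ = 1) :
    ∃ L : EuclideanSpace ℝ (Fin n) ≃ₗᵢ[ℝ] EuclideanSpace ℝ (Fin n), L e = e' :=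
  ⟨_, Submodule.reflection_sub (he.trans he'.symm)⟩

/-- second moment in a direction is `1/n` of the total. -/
lemma second_moment (w : ℝ → ℝ) (hw : Measurable w) (hw0 : ∀ r, 0 ≤ w r)
    (e : EuclideanSpace ℝ (Fin n)) (he : ‖e‖ = 1) :
    (n : ℝ≥0∞) * ∫⁻ x : EuclideanSpace ℝ (Fin n), ENNReal.ofReal ((inner ℝ e x) ^ 2 * w ‖x‖) =
      ∫⁻ x : EuclideanSpace ℝ (Fin n), ENNReal.ofReal (‖x‖ ^ 2 * w ‖x‖) := by
  set b := EuclideanSpace.basisFun (Fin n) ℝ with hb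
  have h1 : ∀ i, ∫⁻ x : EuclideanSpace ℝ (Fin n), ENNReal.ofReal ((inner ℝ (b i) x) ^ 2 * w ‖x‖) =
      ∫⁻ x : EuclideanSpace ℝ (Fin n), ENNReal.ofReal ((inner ℝ e x) ^ 2 * w ‖x‖) := by
    intro i
    obtain ⟨L, hL⟩ := exists_rot e (b i) he (b.norm_eq_one i)
    rw [← L.measurePreserving.lintegral_comp_emb L.toHomeomorph.measurableEmbedding]
    congr 1; ext x
    rw [← hL, L.inner_map_map, L.norm_map]
  have h2 : ∀ x : EuclideanSpace ℝ (Fin n), ENNReal.ofReal (‖x‖ ^ 2 * w ‖x‖) =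
      ∑ i, ENNReal.ofReal ((inner ℝ (b i) x) ^ 2 * w ‖x‖) := by
    intro x
    rw [← ENNReal.ofReal_sum_of_nonneg (fun i _ => mul_nonneg (sq_nonneg _) (hw0 _)), ← Finset.sum_mul,
      ← b.sum_sq_norm_inner_right x]
    simp
  simp_rw [h2]
  rw [lintegral_finsetSum]
  · simp [h1]
  · intro i _
    fun_prop

lemma swap {Z : Set (EuclideanSpace ℝ (Fin n) × EuclideanSpace ℝ (Fin n))} (hZ : MeasurableSet Z) :
    ∫⁻ x, volume {u | (x, u) ∈ Z} = ∫⁻ u, volume {x | (x, u) ∈ Z} := by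
  have h1 := Measure.prod_apply (μ := (volume : Measure (EuclideanSpace ℝ (Fin n)))) (ν := (volume : Measure (EuclideanSpace ℝ (Fin n)))) hZ
  have h2 := Measure.prod_apply_symm (μ := (volume : Measure (EuclideanSpace ℝ (Fin n)))) (ν := (volume : Measure (EuclideanSpace ℝ (Fin n)))) hZ
  exact h1.symm.trans h2

/-- volume lost when shifting. -/
noncomputable def lost (K : Set (EuclideanSpace ℝ (Fin n))) (u : EuclideanSpace ℝ (Fin n)) : ℝ≥0∞ :=
  volume {x | x ∈ K ∧ x + u ∉ K}

lemma lost_add {K : Set (EuclideanSpace ℝ (Fin n))} (u v) :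
    lost K (u + v) ≤ lost K u + lost K v := by
  unfold lost
  have h := measure_preimage_add_right volume u {x | x ∈ K ∧ x + v ∉ K}
  rw [← h]
  refine le_trans (measure_mono ?_) (measure_union_le _ _)
  rintro x ⟨h1, h2⟩
  by_cases h3 : x + u ∈ K
  · right
    refine ⟨h3, ?_⟩
    rwa [add_assoc]
  · exact Or.inl ⟨h1, h3⟩

lemma lost_nsmul {K : Set (EuclideanSpace ℝ (Fin n))} (u) (m : ℕ) :
    lost K (m • u) ≤ m * lost K u := by
  induction m with
  | zero => simp [lost]
  | succ m ih =>
    rw [succ_nsmul, Nat.cast_succ, add_mul, one_mul]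
    exact (lost_add _ _).trans (by gcongr)

lemma lost_eq {K : Set (EuclideanSpace ℝ (Fin n))} (u) :
    lost K u = volume {x | x ∉ K ∧ x - u ∈ K} := by
  unfold lost
  rw [← measure_preimage_add_right volume u {x | x ∉ K ∧ x - u ∈ K}]
  congr 1; ext x; simp [and_comm]

lemma separate {K : Set (EuclideanSpace ℝ (Fin n))} (hc : Convex ℝ K)
    (hB : Metric.closedBall 0 1 ⊆ K) {x : EuclideanSpace ℝ (Fin n)} (hx : 1 ≤ gauge K x) :
    ∃ e : EuclideanSpace ℝ (Fin n), ‖e‖ = 1 ∧ ∀ w, x - w ∈ K → gauge K x - 1 ≤ inner ℝ e w := by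
  have hK0 : K ∈ 𝓝 (0 : EuclideanSpace ℝ (Fin n)) := mem_of_superset (Metric.closedBall_mem_nhds 0 one_pos) hB
  have h0 : 0 < gauge K x := by linarith
  set ρ := gauge K x with hρ
  have hp : ρ⁻¹ • x ∉ interior K := by
    rw [← gauge_lt_one_iff_mem_interior hc hK0, gauge_smul_of_nonneg (by positivity), ← hρ, smul_eq_mul,
      inv_mul_cancel₀ h0.ne']
    exact lt_irrefl _
  obtain ⟨f, hf⟩ := geometric_hahn_banach_open_point hc.interior isOpen_interior hp
  set p := ρ⁻¹ • x with hpd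
  have hfx : f x = ρ * f p := by
    rw [hpd, map_smul, smul_eq_mul, mul_inv_cancel_left₀ h0.ne']
  have hf0 : 0 < f p := by simpa using hf 0 (mem_interior_iff_mem_nhds.2 hK0)
  have hfK : ∀ k ∈ K, f k ≤ f p := by
    intro k hk
    have hk' : k ∈ closure (interior K) := by
      rw [hc.closure_interior_eq_closure_of_nonempty_interior ⟨0, mem_interior_iff_mem_nhds.2 hK0⟩]
      exact subset_closure hk
    have : closure (interior K) ⊆ {y | f y ≤ f p} :=
      closure_minimal (fun y hy => (hf y hy).le) (isClosed_le f.continuous continuous_const)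
    exact this hk'
  set a := (InnerProductSpace.toDual ℝ (EuclideanSpace ℝ (Fin n))).symm f with ha
  have hin : ∀ y, inner ℝ a y = f y := fun y => InnerProductSpace.toDual_symm_apply
  have ha0 : 0 < ‖a‖ := by
    rw [norm_pos_iff]
    rintro h
    have := hin p
    rw [h, inner_zero_left] at this
    linarith
  have hap : ‖a‖ ≤ f p := by
    have h1 := hfK (‖a‖⁻¹ • a) (hB (by
      rw [mem_closedBall_zero_iff, norm_smul, norm_inv, norm_norm, inv_mul_cancel₀ ha0.ne']))
    rw [map_smul, ← hin a, real_inner_self_eq_norm_sq, smul_eq_mul, sq, inv_mul_cancel_left₀ ha0.ne'] at h1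
    exact h1
  refine ⟨‖a‖⁻¹ • a, by rw [norm_smul, norm_inv, norm_norm, inv_mul_cancel₀ ha0.ne'], fun w hw => ?_⟩
  have h1 := hfK _ hw
  rw [map_sub, hfx] at h1
  rw [inner_smul_left, hin]
  simp only [conj_trivial]
  rw [← div_eq_inv_mul, le_div_iff₀ ha0]
  nlinarith

lemma gauge_vol {K : Set (EuclideanSpace ℝ (Fin n))} (hK : IsCompact K) (hc : Convex ℝ K)
    (hB : Metric.closedBall 0 1 ⊆ K) (y : ℝ) (hy : 0 ≤ y) :
    volume {x | x ∉ K ∧ gauge K x ≤ 1 + y} ≤ ENNReal.ofReal ((1 + y) ^ n - 1) * volume K := by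
  have hK0 : K ∈ 𝓝 (0 : EuclideanSpace ℝ (Fin n)) := mem_of_superset (Metric.closedBall_mem_nhds 0 one_pos) hB
  have h1 : {x | x ∉ K ∧ gauge K x ≤ 1 + y} = (1 + y) • K \ K := by
    ext x
    rw [mem_ofPred_eq, Set.mem_sdiff, and_comm]
    refine and_congr_left fun _ => ?_
    rw [mem_smul_set_iff_inv_smul_mem₀ (by positivity), ← hK.isClosed.closure_eq,
      ← gauge_le_one_iff_mem_closure hc hK0, gauge_smul_of_nonneg (by positivity), smul_eq_mul,
      inv_mul_le_iff₀ (by positivity), mul_one, hK.isClosed.closure_eq]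
  have h2 : K ⊆ (1 + y) • K := by
    intro x hx
    rw [mem_smul_set_iff_inv_smul_mem₀ (by positivity)]
    exact hc.smul_mem_of_zero_mem (hB (by simp)) hx ⟨by positivity, inv_le_one_of_one_le₀ (by linarith)⟩
  have hp : 1 ≤ (1 + y) ^ n := one_le_pow₀ (by linarith)
  rw [h1, measure_sdiff h2 hK.measurableSet.nullMeasurableSet hK.measure_ne_top, Measure.addHaar_smul,
    finrank_euclideanSpace, Fintype.card_fin, abs_of_nonneg (by positivity), ENNReal.ofReal_sub _ zero_le_one,
    ENNReal.sub_mul (fun _ _ => hK.measure_ne_top)]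
  simp

lemma pow_bound (hn : 2 ≤ n) {y : ℝ} (h0 : 0 ≤ y) (h1 : n * y ≤ 1/10) : (1 + y) ^ n - 1 ≤ 11/10 * (n * y) := by
  have h2 : (1 + y) ^ n ≤ Real.exp (n * y) := by
    rw [Real.exp_nat_mul]
    gcongr
    linarith [Real.add_one_le_exp y]
  have h3 : 0 ≤ n * y := by positivity
  have h4 := abs_le.1 (Real.abs_exp_sub_one_sub_id_le (x := n * y) (by rw [abs_of_nonneg h3]; linarith))
  nlinarith [h4.2]

lemma first_moment (hn : 2 ≤ n) (e : EuclideanSpace ℝ (Fin n)) (he : ‖e‖ = 1) :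
    (n : ℝ≥0∞) * ∫⁻ x in Metric.closedBall (0 : EuclideanSpace ℝ (Fin n)) 1, ENNReal.ofReal |inner ℝ e x| ≤
      ENNReal.ofReal (√n) * volume (Metric.closedBall (0 : EuclideanSpace ℝ (Fin n)) 1) := by
  set B := Metric.closedBall (0 : EuclideanSpace ℝ (Fin n)) 1 with hB
  have hBm : MeasurableSet B := measurableSet_closedBall
  have hs : 0 < √(n:ℝ) := by positivity
  have hss : √(n:ℝ) * √n = n := Real.mul_self_sqrt (by positivity)
  set w : ℝ → ℝ := (Iic 1).indicator 1 with hw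
  have hwm : Measurable w := measurable_one.indicator measurableSet_Iic
  have hw0 : ∀ r, 0 ≤ w r := fun r => indicator_nonneg (fun _ _ => zero_le_one) _
  have hm := second_moment w hwm hw0 e he
  have hwB : ∀ x : EuclideanSpace ℝ (Fin n), x ∈ B → w ‖x‖ = 1 := fun x hx => by
    simp only [hw]; rw [indicator_of_mem]; rfl
    simpa [hB] using hx
  have hwB' : ∀ x : EuclideanSpace ℝ (Fin n), x ∉ B → w ‖x‖ = 0 := fun x hx => by
    simp only [hw]; rw [indicator_of_notMem]
    simpa [hB] using hx
  have h1 : ∀ g : EuclideanSpace ℝ (Fin n) → ℝ, ∫⁻ x, ENNReal.ofReal (g x * w ‖x‖) = ∫⁻ x in B, ENNReal.ofReal (g x) := by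
    intro g
    rw [← lintegral_indicator hBm]
    congr 1; ext x
    by_cases hx : x ∈ B
    · rw [indicator_of_mem hx, hwB x hx, mul_one]
    · rw [indicator_of_notMem hx, hwB' x hx]; simp
  rw [h1, h1] at hm
  have h2 : ∫⁻ x in B, ENNReal.ofReal (‖x‖ ^ 2) ≤ volume B := by
    calc ∫⁻ x in B, ENNReal.ofReal (‖x‖ ^ 2) ≤ ∫⁻ x in B, 1 := by
          refine setLIntegral_mono' hBm fun x hx => ?_
          rw [ENNReal.ofReal_le_one]
          rw [hB, mem_closedBall_zero_iff] at hx
          exact pow_le_one₀ (norm_nonneg _) hx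
      _ = volume B := by simp
  calc (n : ℝ≥0∞) * ∫⁻ x in B, ENNReal.ofReal |inner ℝ e x|
      ≤ n * ∫⁻ x in B, (ENNReal.ofReal (√n / 2) * ENNReal.ofReal (inner ℝ e x ^ 2) + ENNReal.ofReal (1 / (2 * √n))) := by
        gcongr with x
        rw [← ENNReal.ofReal_mul (by positivity), ← ENNReal.ofReal_add (by positivity) (by positivity)]
        refine ENNReal.ofReal_le_ofReal ?_
        rw [← sq_abs]
        set y := |inner ℝ e x|
        have : √n / 2 * y ^ 2 + 1 / (2 * √n) - y = (√n * y - 1)^2 / (2 * √n) := by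
          field_simp; ring
        have h3 : 0 ≤ (√n * y - 1)^2 / (2 * √n) := by positivity
        linarith
    _ = ENNReal.ofReal (√n / 2) * (n * ∫⁻ x in B, ENNReal.ofReal (inner ℝ e x ^ 2)) + n * ENNReal.ofReal (1 / (2 * √n)) * volume B := by
        rw [lintegral_add_right _ measurable_const, lintegral_const_mul _ (by fun_prop), lintegral_const]
        simp; ring
    _ ≤ ENNReal.ofReal (√n / 2) * volume B + n * ENNReal.ofReal (1 / (2 * √n)) * volume B := by
        rw [hm]; gcongr
    _ = _ := by
        rw [← add_mul]
        congr 1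
        rw [← ENNReal.ofReal_natCast, ← ENNReal.ofReal_mul (by positivity), ← ENNReal.ofReal_add (by positivity) (by positivity)]
        congr 1
        field_simp; nlinarith

lemma int_bad (hn : 2 ≤ n) {K : Set (EuclideanSpace ℝ (Fin n))} (hK : IsCompact K) (hc : Convex ℝ K)
    (hB : Metric.closedBall 0 1 ⊆ K) {t : ℝ} (ht : 0 ≤ t) (ht1 : t ≤ 1/10) :
    ∫⁻ x, volume {u | x ∈ K ∧ ‖u‖ ≤ 1 ∧ x + t • u ∉ K} ≤ ENNReal.ofReal (11/10 * (t * √n)) * volume K *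
      volume (Metric.closedBall (0 : EuclideanSpace ℝ (Fin n)) 1) := by
  have hK0 : K ∈ 𝓝 (0 : EuclideanSpace ℝ (Fin n)) := mem_of_superset (Metric.closedBall_mem_nhds 0 one_pos) hB
  have hKm := hK.measurableSet
  have n0 : (n : ℝ) ≠ 0 := by positivity
  have : Nonempty (Fin n) := ⟨⟨0, by omega⟩⟩
  obtain ⟨e, he⟩ := exists_norm_eq (EuclideanSpace ℝ (Fin n)) zero_le_one
  have hBm : MeasurableSet (Metric.closedBall (0 : EuclideanSpace ℝ (Fin n)) 1) := measurableSet_closedBall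
  have hg := (continuous_gauge hc hK0).measurable
  have m1 : MeasurableSet {p : EuclideanSpace ℝ (Fin n) × EuclideanSpace ℝ (Fin n) | p.1 ∈ K ∧ ‖p.2‖ ≤ 1 ∧ p.1 + t • p.2 ∉ K} := by
    refine (measurable_fst hKm).inter ((measurableSet_le measurable_snd.norm measurable_const).inter ?_)
    exact ((by fun_prop : Measurable fun p : EuclideanSpace ℝ (Fin n) × EuclideanSpace ℝ (Fin n) => p.1 + t • p.2) hKm).compl
  have m2 : MeasurableSet {p : EuclideanSpace ℝ (Fin n) × EuclideanSpace ℝ (Fin n) | p.1 ∉ K ∧ ‖p.2‖ ≤ 1 ∧ p.1 - (t / n) • p.2 ∈ K} := by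
    refine (measurable_fst hKm).compl.inter ((measurableSet_le measurable_snd.norm measurable_const).inter ?_)
    exact ((by fun_prop : Measurable fun p : EuclideanSpace ℝ (Fin n) × EuclideanSpace ℝ (Fin n) => p.1 - (t / n) • p.2) hKm)
  have m3 : MeasurableSet {p : EuclideanSpace ℝ (Fin n) × EuclideanSpace ℝ (Fin n) | p.1 ∉ K ∧ ‖p.2‖ ≤ 1 ∧ gauge K p.1 - 1 ≤ t / n * inner ℝ e p.2} := by
    refine (measurable_fst hKm).compl.inter ((measurableSet_le measurable_snd.norm measurable_const).inter ?_)
    exact measurableSet_le (f := fun p : EuclideanSpace ℝ (Fin n) × EuclideanSpace ℝ (Fin n) => gauge K p.1 - 1)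
      (g := fun p => t / n * inner ℝ e p.2) (by fun_prop) (by fun_prop)
  have s1 : ∫⁻ x, volume {u | x ∈ K ∧ ‖u‖ ≤ 1 ∧ x + t • u ∉ K} = ∫⁻ u, volume {x | x ∈ K ∧ ‖u‖ ≤ 1 ∧ x + t • u ∉ K} := swap m1
  have s2 : ∫⁻ x, volume {u | x ∉ K ∧ ‖u‖ ≤ 1 ∧ x - (t / n) • u ∈ K} = ∫⁻ u, volume {x | x ∉ K ∧ ‖u‖ ≤ 1 ∧ x - (t / n) • u ∈ K} := swap m2
  have s3 : ∫⁻ x, volume {u | x ∉ K ∧ ‖u‖ ≤ 1 ∧ gauge K x - 1 ≤ t / n * inner ℝ e u} = ∫⁻ u, volume {x | x ∉ K ∧ ‖u‖ ≤ 1 ∧ gauge K x - 1 ≤ t / n * inner ℝ e u} := swap m3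
  have a1 : ∀ u, volume {x | x ∈ K ∧ ‖u‖ ≤ 1 ∧ x + t • u ∉ K} ≤ n * volume {x | x ∉ K ∧ ‖u‖ ≤ 1 ∧ x - (t / n) • u ∈ K} := by
    intro u
    by_cases hu : ‖u‖ ≤ 1
    · simp only [hu, true_and]
      have := lost_nsmul (K := K) ((t / n) • u) n
      rw [lost_eq ((t / n) • u)] at this
      rw [← Nat.cast_smul_eq_nsmul ℝ, smul_smul, mul_div_cancel₀ _ n0] at this
      exact this
    · simp [hu]
  have a2 : ∀ x, volume {u | x ∉ K ∧ ‖u‖ ≤ 1 ∧ x - (t / n) • u ∈ K} ≤ volume {u | x ∉ K ∧ ‖u‖ ≤ 1 ∧ gauge K x - 1 ≤ t / n * inner ℝ e u} := by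
    intro x
    by_cases hx : x ∈ K
    · simp [hx]
    simp only [hx, not_false_eq_true, true_and]
    have hx1 : 1 ≤ gauge K x := by
      by_contra h
      push Not at h
      exact hx (interior_subset ((gauge_lt_one_iff_mem_interior hc hK0).1 h))
    obtain ⟨e', he', h⟩ := separate hc hB hx1
    obtain ⟨L, hL⟩ := exists_rot e e' he he'
    have mm : MeasurableSet {u | ‖u‖ ≤ 1 ∧ gauge K x - 1 ≤ t / n * inner ℝ e' u} :=
      (measurableSet_le (f := fun u : EuclideanSpace ℝ (Fin n) => ‖u‖) (g := fun _ => 1) (by fun_prop) measurable_const).inter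
        (measurableSet_le (f := fun u : EuclideanSpace ℝ (Fin n) => gauge K x - 1) (g := fun u => t / n * inner ℝ e' u) (by fun_prop) (by fun_prop))
    calc _ ≤ volume {u | ‖u‖ ≤ 1 ∧ gauge K x - 1 ≤ t / n * inner ℝ e' u} := by
          refine measure_mono fun u hu => ⟨hu.1, ?_⟩
          simpa [inner_smul_right] using h _ hu.2
      _ = _ := by
          rw [← L.measurePreserving.measure_preimage mm.nullMeasurableSet]
          congr 1; ext u
          simp only [mem_preimage, mem_ofPred_eq]
          rw [← hL, L.inner_map_map, L.norm_map]
  have a3 : ∀ u, volume {x | x ∉ K ∧ ‖u‖ ≤ 1 ∧ gauge K x - 1 ≤ t / n * inner ℝ e u} ≤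
      (Metric.closedBall (0 : EuclideanSpace ℝ (Fin n)) 1).indicator (fun u => ENNReal.ofReal (11/10 * t) * volume K * ENNReal.ofReal |inner ℝ e u|) u := by
    intro u
    by_cases hu : ‖u‖ ≤ 1
    · rw [indicator_of_mem (by simpa using hu)]
      have hi : |inner ℝ e u| ≤ 1 := by
        have := abs_real_inner_le_norm e u
        rw [he] at this; linarith
      have e1 : n * (t / n * |inner ℝ e u|) = t * |inner ℝ e u| := by field_simp
      have p := pow_bound hn (y := t / n * |inner ℝ e u|) (by positivity) (by
        rw [e1]; nlinarith [abs_nonneg (inner ℝ e u)])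
      rw [e1] at p
      calc _ ≤ volume {x | x ∉ K ∧ gauge K x ≤ 1 + t / n * |inner ℝ e u|} := by
            refine measure_mono fun x hx => ⟨hx.1, ?_⟩
            have : t / n * inner ℝ e u ≤ t / n * |inner ℝ e u| := by gcongr; exact le_abs_self _
            linarith [hx.2.2]
        _ ≤ _ := gauge_vol hK hc hB _ (by positivity)
        _ ≤ ENNReal.ofReal (11/10 * t * |inner ℝ e u|) * volume K := by
            gcongr; linarith
        _ = _ := by
            rw [ENNReal.ofReal_mul (by positivity)]; ring
    · simp [hu]
  calc _ = _ := s1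
    _ ≤ ∫⁻ u, n * volume {x | x ∉ K ∧ ‖u‖ ≤ 1 ∧ x - (t / n) • u ∈ K} := lintegral_mono a1
    _ = n * ∫⁻ u, volume {x | x ∉ K ∧ ‖u‖ ≤ 1 ∧ x - (t / n) • u ∈ K} := lintegral_const_mul' _ _ (by simp)
    _ ≤ n * ∫⁻ u, volume {x | x ∉ K ∧ ‖u‖ ≤ 1 ∧ gauge K x - 1 ≤ t / n * inner ℝ e u} := by
        rw [← s2, ← s3]
        exact mul_le_mul_right (lintegral_mono a2) _
    _ ≤ n * (ENNReal.ofReal (11/10 * t) * volume K * ∫⁻ x in Metric.closedBall (0 : EuclideanSpace ℝ (Fin n)) 1, ENNReal.ofReal |inner ℝ e x|) := by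
        gcongr
        rw [← lintegral_const_mul _ (by fun_prop), ← lintegral_indicator hBm]
        exact lintegral_mono a3
    _ = ENNReal.ofReal (11/10 * t) * volume K * (n * ∫⁻ x in Metric.closedBall (0 : EuclideanSpace ℝ (Fin n)) 1, ENNReal.ofReal |inner ℝ e x|) := by ring
    _ ≤ ENNReal.ofReal (11/10 * t) * volume K * (ENNReal.ofReal (√n) * volume (Metric.closedBall (0 : EuclideanSpace ℝ (Fin n)) 1)) := by
        exact mul_le_mul_right (first_moment hn e he) _
    _ = _ := by
        rw [← mul_assoc (11/10 : ℝ), ENNReal.ofReal_mul (p := 11/10 * t) (by positivity)]; ring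

lemma deep0 (hn : 2 ≤ n) {K : Set (EuclideanSpace ℝ (Fin n))} (hK : IsCompact K) (hc : Convex ℝ K)
    (hB : Metric.closedBall 0 1 ⊆ K) :
    3/4 * volume.real K ≤ volume.real {x ∈ K | 1 / (32 * √n) ≤ sf K x} := by
  have hs : 0 < √(n:ℝ) := by positivity
  have hss : √(n:ℝ) * √n = n := Real.mul_self_sqrt (by positivity)
  have hs1 : 1 ≤ √(n:ℝ) := by rw [Real.one_le_sqrt]; exact_mod_cast (by omega : 1 ≤ n)
  have hn' : (2:ℝ) ≤ n := by exact_mod_cast hn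
  set t := 1 / (32 * √n) with ht
  have ht0 : 0 < t := by positivity
  have ht1 : t ≤ 1 / 10 := by
    rw [ht, div_le_div_iff₀ (by positivity) (by norm_num)]; linarith
  have hts : t * √n = 1/32 := by rw [ht]; field_simp
  have hη : t / √n = 1 / (32 * n) := by rw [ht, div_div, mul_assoc, hss]
  set B := Metric.closedBall (0 : EuclideanSpace ℝ (Fin n)) 1 with hBd
  have B0 : volume B ≠ 0 := (Metric.measure_closedBall_pos _ _ one_pos).ne'
  have Bt : volume B ≠ ⊤ := (isCompact_closedBall _ _).measure_ne_top
  have hI := int_bad hn hK hc hB ht0.le ht1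
  rw [← hBd, hts] at hI
  have m1 : MeasurableSet {p : EuclideanSpace ℝ (Fin n) × EuclideanSpace ℝ (Fin n) | p.1 ∈ K ∧ ‖p.2‖ ≤ 1 ∧ p.1 + t • p.2 ∉ K} := by
    refine (measurable_fst hK.measurableSet).inter ((measurableSet_le measurable_snd.norm measurable_const).inter ?_)
    exact ((by fun_prop : Measurable fun p : EuclideanSpace ℝ (Fin n) × EuclideanSpace ℝ (Fin n) => p.1 + t • p.2) hK.measurableSet).compl
  have hM := mul_meas_ge_le_lintegral (μ := volume) (f := fun x : EuclideanSpace ℝ (Fin n) => volume {u | x ∈ K ∧ ‖u‖ ≤ 1 ∧ x + t • u ∉ K})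
    (measurable_measure_prodMk_left m1) (ENNReal.ofReal (1/4) * volume B)
  set Z := {x : EuclideanSpace ℝ (Fin n) | ENNReal.ofReal (1/4) * volume B ≤ volume {u | x ∈ K ∧ ‖u‖ ≤ 1 ∧ x + t • u ∉ K}} with hZ
  have hZv : volume Z ≤ ENNReal.ofReal (11/80) * volume K := by
    have h1 := hM.trans hI
    have h2 : ENNReal.ofReal (11 / 10 * (1 / 32)) = ENNReal.ofReal (1/4) * ENNReal.ofReal (11/80) := by
      rw [← ENNReal.ofReal_mul (by norm_num)]; norm_num
    rw [h2] at h1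
    have h3 : (ENNReal.ofReal (1/4) * volume B) * volume Z ≤ (ENNReal.ofReal (1/4) * volume B) * (ENNReal.ofReal (11/80) * volume K) := by
      refine h1.trans (le_of_eq ?_); ring
    exact (ENNReal.mul_le_mul_iff_right (mul_ne_zero (by simp) B0) (ENNReal.mul_ne_top (by simp) Bt)).1 h3
  have hsub : (1 - t / √n) • K ⊆ {x ∈ K | t ≤ sf K x} ∪ Z := by
    rintro _ ⟨k, hk, rfl⟩
    have hη1 : t / √n ≤ 1 := by
      rw [hη, div_le_one (by positivity)]; linarith
    have hη0 : 0 ≤ t / √n := by positivity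
    have hball : ∀ u : EuclideanSpace ℝ (Fin n), ‖u‖ ≤ 1 → (1 - t / √n) • k + (t / √n) • u ∈ K := fun u hu =>
      hc hk (hB (by simpa [hBd] using hu)) (by linarith) hη0 (by ring)
    have hxK : (1 - t / √n) • k ∈ K := by simpa using hball 0 (by simp)
    by_cases hz : (1 - t / √n) • k ∈ Z
    · exact Or.inr hz
    · refine Or.inl ⟨hxK, le_sf hn hK ht0.le ⟨?_, hball⟩⟩
      rw [hZ, mem_ofPred_eq, not_le] at hz
      set x := (1 - t / √n) • k
      have h1 : volume B ≤ volume (sect K x t) + volume {u | x ∈ K ∧ ‖u‖ ≤ 1 ∧ x + t • u ∉ K} := by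
        refine (measure_mono ?_).trans (measure_union_le _ _)
        intro u hu
        by_cases h : x + t • u ∈ K
        · exact Or.inl ⟨hu, h⟩
        · exact Or.inr ⟨hxK, by simpa [hBd] using hu, h⟩
      have h2 : volume B = ENNReal.ofReal (3/4) * volume B + ENNReal.ofReal (1/4) * volume B := by
        rw [← add_mul, ← ENNReal.ofReal_add (by norm_num) (by norm_num)]; norm_num
      have h3 : ENNReal.ofReal (3/4) * volume B + ENNReal.ofReal (1/4) * volume B ≤ volume (sect K x t) + ENNReal.ofReal (1/4) * volume B := by
        rw [← h2]; exact h1.trans (by gcongr)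
      exact (ENNReal.add_le_add_iff_right (ENNReal.mul_ne_top (by simp) Bt)).1 h3
  have Kt := hK.measure_ne_top (μ := volume)
  have hv := (measure_mono (μ := volume) hsub).trans (measure_union_le _ _)
  rw [Measure.addHaar_smul, finrank_euclideanSpace, Fintype.card_fin] at hv
  have hGt : volume {x ∈ K | t ≤ sf K x} ≠ ⊤ := ((measure_mono (fun x hx => hx.1)).trans_lt Kt.lt_top).ne
  have hv2 : ENNReal.ofReal |(1 - t / √n) ^ n| * volume K ≤ volume {x ∈ K | t ≤ sf K x} + ENNReal.ofReal (11/80) * volume K :=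
    hv.trans (by gcongr)
  have hv3 := ENNReal.toReal_mono (ENNReal.add_ne_top.2 ⟨hGt, ENNReal.mul_ne_top (by simp) Kt⟩) hv2
  rw [ENNReal.toReal_add hGt (ENNReal.mul_ne_top (by simp) Kt), ENNReal.toReal_mul, ENNReal.toReal_mul,
    ENNReal.toReal_ofReal (abs_nonneg _), ENNReal.toReal_ofReal (by norm_num)] at hv3
  have hb := one_add_mul_le_pow (a := -(t / √n)) (by
    rw [hη]
    have : 1 / (32 * (n:ℝ)) ≤ 2 := by rw [div_le_iff₀ (by positivity)]; linarith
    linarith) n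
  have hb2 : 31/32 ≤ |(1 - t / √n) ^ n| := by
    refine le_trans ?_ (le_abs_self _)
    refine le_trans (le_of_eq ?_) hb
    rw [hη]; field_simp; norm_num
  have hk0 : 0 ≤ (volume K).toReal := ENNReal.toReal_nonneg
  simp only [Measure.real]
  nlinarith

lemma sf_translate (K : Set (EuclideanSpace ℝ (Fin n))) (z x : EuclideanSpace ℝ (Fin n)) :
    sf ((fun y => y + z) ⁻¹' K) x = sf K (x + z) := by
  unfold sf good sect
  simp only [mem_preimage, add_right_comm]

lemma deep (hn : 2 ≤ n) {K : Set (EuclideanSpace ℝ (Fin n))} (hK : IsCompact K) (hc : Convex ℝ K)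
    (hB : ∃ z, Metric.closedBall z 1 ⊆ K) :
    3/4 * volume.real K ≤ volume.real {x ∈ K | 1 / (32 * √n) ≤ sf K x} := by
  obtain ⟨z, hz⟩ := hB
  have h := deep0 hn (K := (fun y => y + z) ⁻¹' K)
    ((Homeomorph.addRight z).isCompact_preimage.2 hK) (hc.translate_preimage_left z) (by
      intro x hx
      apply hz
      simpa using hx)
  simp only [Measure.real] at h ⊢
  rw [measure_preimage_add_right] at h
  simp only [sf_translate] at h
  have e : {x | x ∈ (fun y => y + z) ⁻¹' K ∧ 1 / (32 * √n) ≤ sf K (x + z)} = (fun y => y + z) ⁻¹' {x ∈ K | 1 / (32 * √n) ≤ sf K x} := rfl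
  rw [e, measure_preimage_add_right] at h
  exact h

end deep
end HR

end Part5

section Part6
open MeasureTheory Set Filter Topology
open scoped ENNReal Pointwise

namespace HR

section polar
variable {n : ℕ}

lemma polar (hn : 2 ≤ n) {F : EuclideanSpace ℝ (Fin n) → ℝ≥0∞} (hF : Measurable F) :
    ∫⁻ x, F x = ∫⁻ θ : Metric.sphere (0 : EuclideanSpace ℝ (Fin n)) 1, (∫⁻ r in Ioi (0:ℝ),
      ENNReal.ofReal (r ^ (n - 1)) * F (r • (θ : EuclideanSpace ℝ (Fin n)))) ∂(volume.toSphere) := by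
  have : Nontrivial (EuclideanSpace ℝ (Fin n)) := by
    have : Nonempty (Fin n) := ⟨⟨0, by omega⟩⟩
    infer_instance
  have mp := (volume : Measure (EuclideanSpace ℝ (Fin n))).measurePreserving_homeomorphUnitSphereProd
  rw [finrank_euclideanSpace, Fintype.card_fin] at mp
  have h1 : ∫⁻ x, F x = ∫⁻ x : ({0}ᶜ : Set (EuclideanSpace ℝ (Fin n))), F x ∂(Measure.comap Subtype.val volume) := by
    rw [lintegral_subtype_comap (measurableSet_singleton _).compl, restrict_compl_singleton]
  have h2 : ∫⁻ x : ({0}ᶜ : Set (EuclideanSpace ℝ (Fin n))), F x ∂(Measure.comap Subtype.val volume) =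
      ∫⁻ p, F ((homeomorphUnitSphereProd (EuclideanSpace ℝ (Fin n))).symm p) ∂(volume.toSphere.prod (Measure.volumeIoiPow (n - 1))) := by
    rw [← mp.lintegral_comp_emb (Homeomorph.measurableEmbedding _)]
    simp
  rw [h1, h2, lintegral_prod]
  · congr 1; ext θ
    rw [Measure.volumeIoiPow, lintegral_withDensity_eq_lintegral_mul]
    · rw [← lintegral_subtype_comap measurableSet_Ioi]
      rfl
    · fun_prop
    · fun_prop
  · exact (hF.comp (by fun_prop)).aemeasurable

lemma coneInt (hn : 2 ≤ n) {C : Set (EuclideanSpace ℝ (Fin n))} (hC : MeasurableSet C)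
    (hCc : ∀ (r : ℝ), 0 < r → ∀ x, x ∈ C → r • x ∈ C) {g : EuclideanSpace ℝ (Fin n) → ℝ}
    (hg : Measurable g) (hgc : ∀ (r : ℝ), 0 < r → ∀ x, g (r • x) = r * g x) (hg0 : ∀ x, x ≠ 0 → 0 < g x) :
    ENNReal.ofReal (n / 2) * volume (C ∩ Metric.closedBall 0 1) ≤
      ∫⁻ y in C ∩ {y | 1/2 ≤ g y ∧ g y ≤ 1}, ENNReal.ofReal (g y / ‖y‖ ^ n) := by
  have : Nontrivial (EuclideanSpace ℝ (Fin n)) := by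
    have : Nonempty (Fin n) := ⟨⟨0, by omega⟩⟩
    infer_instance
  set X := C ∩ {y | 1/2 ≤ g y ∧ g y ≤ 1} with hX
  have hXm : MeasurableSet X := hC.inter (hg measurableSet_Icc)
  set s : Set (Metric.sphere (0 : EuclideanSpace ℝ (Fin n)) 1) := {θ | (θ : EuclideanSpace ℝ (Fin n)) ∈ C} with hs
  have hsm : MeasurableSet s := measurable_subtype_coe hC
  have h1 : n * volume (C ∩ Metric.closedBall 0 1) ≤ (volume : Measure (EuclideanSpace ℝ (Fin n))).toSphere s := by
    rw [Measure.toSphere_apply' _ hsm, finrank_euclideanSpace, Fintype.card_fin]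
    refine mul_le_mul_right ?_ _
    have h2 : C ∩ Metric.closedBall 0 1 ⊆ (Ioo (0:ℝ) 1 • ((Subtype.val '' s : Set (EuclideanSpace ℝ (Fin n))))) ∪ (Metric.sphere 0 1 ∪ {0}) := by
      rintro x ⟨hxC, hxB⟩
      rw [mem_closedBall_zero_iff] at hxB
      by_cases h0 : x = 0
      · right; right; exact h0
      by_cases h1 : ‖x‖ = 1
      · right; left; simpa using h1
      left
      have hx0 : 0 < ‖x‖ := norm_pos_iff.2 h0
      refine Set.mem_smul.2 ⟨‖x‖, ⟨hx0, lt_of_le_of_ne hxB h1⟩, ‖x‖⁻¹ • x, ⟨⟨‖x‖⁻¹ • x, ?_⟩, hCc _ (by positivity) _ hxC, rfl⟩, ?_⟩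
      · simp [norm_smul, hx0.ne']
      · rw [smul_smul, mul_inv_cancel₀ hx0.ne', one_smul]
    refine (measure_mono h2).trans ((measure_union_le _ _).trans ?_)
    have h3 : volume (Metric.sphere (0 : EuclideanSpace ℝ (Fin n)) 1 ∪ {0}) = 0 := by
      rw [measure_union_null_iff]
      exact ⟨Measure.addHaar_sphere _ _ _, measure_singleton _⟩
    rw [h3, add_zero]
  have hdm : Measurable fun y : EuclideanSpace ℝ (Fin n) => ENNReal.ofReal (g y / ‖y‖ ^ n) := by fun_prop
  rw [← lintegral_indicator hXm, polar hn (hdm.indicator hXm)]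
  calc ENNReal.ofReal (n / 2) * volume (C ∩ Metric.closedBall 0 1)
      = ENNReal.ofReal (1 / 2) * (n * volume (C ∩ Metric.closedBall 0 1)) := by
        rw [← mul_assoc, ← ENNReal.ofReal_natCast n, ← ENNReal.ofReal_mul (by positivity)]
        congr 2; ring
    _ ≤ ENNReal.ofReal (1 / 2) * (volume : Measure (EuclideanSpace ℝ (Fin n))).toSphere s := by gcongr
    _ = ∫⁻ θ in s, ENNReal.ofReal (1/2) ∂(volume : Measure (EuclideanSpace ℝ (Fin n))).toSphere := by
        rw [setLIntegral_const]
    _ ≤ ∫⁻ θ in s, (∫⁻ r in Ioi (0:ℝ),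
      ENNReal.ofReal (r ^ (n - 1)) * X.indicator (fun y => ENNReal.ofReal (g y / ‖y‖ ^ n)) (r • (θ : EuclideanSpace ℝ (Fin n)))) ∂(volume.toSphere) := by
        refine setLIntegral_mono' hsm fun θ hθ => ?_
        have hθn : ‖(θ : EuclideanSpace ℝ (Fin n))‖ = 1 := by simpa using θ.2
        set G := g θ with hG
        have hG0 : 0 < G := hg0 _ (by rw [← norm_pos_iff, hθn]; norm_num)
        calc ENNReal.ofReal (1/2) = ∫⁻ r in Icc (1 / (2 * G)) (1 / G), ENNReal.ofReal G := by
              rw [setLIntegral_const, Real.volume_Icc, ← ENNReal.ofReal_mul hG0.le]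
              congr 1; field_simp; norm_num
          _ ≤ ∫⁻ r in Icc (1 / (2 * G)) (1 / G), ENNReal.ofReal (r ^ (n - 1)) * X.indicator (fun y => ENNReal.ofReal (g y / ‖y‖ ^ n)) (r • (θ : EuclideanSpace ℝ (Fin n))) := by
              refine setLIntegral_mono' measurableSet_Icc fun r hr => ?_
              have hr0 : 0 < r := lt_of_lt_of_le (by positivity) hr.1
              have hgr : g (r • (θ : EuclideanSpace ℝ (Fin n))) = r * G := hgc r hr0 _
              rw [indicator_of_mem, ← ENNReal.ofReal_mul (by positivity), hgr, norm_smul, hθn, mul_one, Real.norm_of_nonneg hr0.le]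
              · refine ENNReal.ofReal_le_ofReal (le_of_eq ?_)
                obtain ⟨m, rfl⟩ : ∃ m, n = m + 1 := ⟨n - 1, by omega⟩
                simp only [Nat.add_sub_cancel]
                field_simp
                ring
              · refine ⟨hCc r hr0 _ hθ, ?_, ?_⟩
                · rw [hgr]
                  have := hr.1
                  rw [div_le_iff₀ (by positivity)] at this
                  linarith
                · rw [hgr]
                  have := hr.2
                  rwa [le_div_iff₀ (by positivity)] at this
          _ ≤ _ := by
              refine lintegral_mono_set fun r hr => ?_
              exact lt_of_lt_of_le (by positivity) hr.1
    _ ≤ _ := setLIntegral_le_lintegral _ _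

end polar
end HR

end Part6

section Part7
open MeasureTheory Set Filter Topology
open scoped ENNReal Pointwise

namespace HR

section overlap
variable {n : ℕ}

/-- normalized chord length -/
noncomputable def len (K : Set (EuclideanSpace ℝ (Fin n))) (u x : EuclideanSpace ℝ (Fin n)) : ℝ :=
  (volume {s : ℝ | u + s • (x - u) ∈ K}).toReal

/-- density of hit-and-run -/
noncomputable def dens (K : Set (EuclideanSpace ℝ (Fin n))) (u x : EuclideanSpace ℝ (Fin n)) : ℝ≥0∞ :=
  ENNReal.ofReal (2 / (n * volume.real (Metric.closedBall (0 : EuclideanSpace ℝ (Fin n)) 1)) *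
    (len K u x * ‖x - u‖ ^ n)⁻¹)

lemma mem_iff_gauge {K : Set (EuclideanSpace ℝ (Fin n))} (hK : IsCompact K) (hc : Convex ℝ K)
    (h0 : K ∈ 𝓝 (0 : EuclideanSpace ℝ (Fin n))) (x) : x ∈ K ↔ gauge K x ≤ 1 := by
  rw [gauge_le_one_iff_mem_closure hc h0, hK.isClosed.closure_eq]

lemma gpos {K : Set (EuclideanSpace ℝ (Fin n))} (hK : IsCompact K)
    (h0 : K ∈ 𝓝 (0 : EuclideanSpace ℝ (Fin n))) {y} (hy : y ≠ 0) : 0 < gauge K y :=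
  (gauge_pos (absorbent_nhds_zero h0) (NormedSpace.isVonNBounded_of_isBounded _ hK.isBounded)).2 hy

lemma len0 {K : Set (EuclideanSpace ℝ (Fin n))} (hK : IsCompact K) (hc : Convex ℝ K)
    (h0 : K ∈ 𝓝 (0 : EuclideanSpace ℝ (Fin n))) {y} (hy : y ≠ 0) :
    len K 0 y = 1 / gauge K y + 1 / gauge K (-y) := by
  have h1 := gpos hK h0 hy
  have h2 := gpos hK h0 (neg_ne_zero.2 hy)
  have : {s : ℝ | (0 : EuclideanSpace ℝ (Fin n)) + s • (y - 0) ∈ K} = Icc (-(1 / gauge K (-y))) (1 / gauge K y) := by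
    ext s
    simp only [mem_ofPred_eq, zero_add, sub_zero, mem_Icc]
    rw [mem_iff_gauge hK hc h0]
    rcases le_total 0 s with hs | hs
    · rw [gauge_smul_of_nonneg hs, smul_eq_mul, le_div_iff₀ h1]
      have : -(1 / gauge K (-y)) ≤ s := le_trans (by simp; positivity) hs
      simp only [this, true_and]
    · have : s • y = (-s) • (-y) := by simp
      rw [this, gauge_smul_of_nonneg (by linarith), smul_eq_mul, ← le_div_iff₀ h2]
      have : s ≤ 1 / gauge K y := le_trans hs (by positivity)
      simp only [this, and_true]
      constructor <;> intro h <;> linarith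
  have h3 : 0 < 1 / gauge K y := by positivity
  have h4 : 0 < 1 / gauge K (-y) := by positivity
  rw [len, this, Real.volume_Icc, ENNReal.toReal_ofReal (by linarith)]
  ring

lemma lenw {K : Set (EuclideanSpace ℝ (Fin n))} (hK : IsCompact K) (hc : Convex ℝ K)
    (h0 : K ∈ 𝓝 (0 : EuclideanSpace ℝ (Fin n))) {y w} (hw1 : (4:ℝ) • w ∈ K) (hw2 : (-4:ℝ) • w ∈ K)
    (hg1 : 1/2 ≤ gauge K y) (hg2 : gauge K y ≤ 1) (hg : gauge K y ≤ gauge K (-y)) :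
    len K w y ≤ 2 * (1 / gauge K y + 1 / gauge K (-y)) := by
  set g := gauge K y with hgd
  set g' := gauge K (-y) with hgd'
  have g0 : 0 < g := by linarith
  have g0' : 0 < g' := by linarith
  have h3 : {s : ℝ | w + s • (y - w) ∈ K} ⊆ Icc (-(5/2 / g')) (3/2 / g) := by
    intro s hs
    have hs : w + s • (y - w) ∈ K := hs
    refine ⟨?_, ?_⟩
    · by_contra hlt
      push Not at hlt
      have hp : 0 < 5/2 / g' := by positivity
      have hs0 : s < 0 := by linarith
      have hd : 0 < 5 - s := by linarith
      have hm := hc hs hw2 (a := 4 / (5 - s)) (b := 1 - 4 / (5 - s)) (by positivity)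
        (by rw [sub_nonneg, div_le_one hd]; linarith) (by ring)
      have e : (4 / (5 - s)) • (w + s • (y - w)) + (1 - 4 / (5 - s)) • ((-4:ℝ) • w) = (4 * (-s) / (5 - s)) • (-y) := by
        have h1 : (4 / (5 - s)) * (1 - s) + (1 - 4 / (5 - s)) * (-4) = 0 := by field_simp; ring
        have h2 : (4 / (5 - s)) • (w + s • (y - w)) + (1 - 4 / (5 - s)) • ((-4:ℝ) • w) =
          (4 * (-s) / (5 - s)) • (-y) + ((4 / (5 - s)) * (1 - s) + (1 - 4 / (5 - s)) * (-4)) • w := by module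
        rw [h2, h1]; simp
      rw [e, mem_iff_gauge hK hc h0, gauge_smul_of_nonneg (div_nonneg (by linarith) hd.le), ← hgd', smul_eq_mul,
        div_mul_eq_mul_div, div_le_one hd] at hm
      have h4 : s * g' < -(5/2) := by
        have := mul_lt_mul_of_pos_right hlt g0'
        have e2 : -(5/2 / g') * g' = -(5/2) := by field_simp
        linarith
      nlinarith
    · by_contra hlt
      push Not at hlt
      have hp : 3/2 ≤ 3/2 / g := by rw [le_div_iff₀ g0]; linarith
      have hs0 : 1 < s := by linarith
      have hd : 0 < s + 3 := by linarith
      have hm := hc hs hw1 (a := 4 / (s + 3)) (b := 1 - 4 / (s + 3)) (by positivity)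
        (by rw [sub_nonneg, div_le_one hd]; linarith) (by ring)
      have e : (4 / (s + 3)) • (w + s • (y - w)) + (1 - 4 / (s + 3)) • ((4:ℝ) • w) = (4 * s / (s + 3)) • y := by
        have h1 : (4 / (s + 3)) * (1 - s) + (1 - 4 / (s + 3)) * 4 = 0 := by field_simp; ring
        have h2 : (4 / (s + 3)) • (w + s • (y - w)) + (1 - 4 / (s + 3)) • ((4:ℝ) • w) =
          (4 * s / (s + 3)) • y + ((4 / (s + 3)) * (1 - s) + (1 - 4 / (s + 3)) * 4) • w := by module
        rw [h2, h1]; simp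
      rw [e, mem_iff_gauge hK hc h0, gauge_smul_of_nonneg (div_nonneg (by linarith) hd.le), ← hgd, smul_eq_mul,
        div_mul_eq_mul_div, div_le_one hd] at hm
      have h4 : 3/2 < s * g := by
        have := mul_lt_mul_of_pos_right hlt g0
        have e2 : (3/2 / g) * g = 3/2 := by field_simp
        linarith
      nlinarith
  have h4 : 0 < 5/2 / g' := by positivity
  have h5 : 0 < 3/2 / g := by positivity
  have h6 : len K w y ≤ 3/2 / g + 5/2 / g' := by
    have := ENNReal.toReal_mono (by simp) (measure_mono (μ := volume) h3)
    rw [Real.volume_Icc, ENNReal.toReal_ofReal (by linarith)] at this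
    unfold len; linarith
  have h7 : 1 / g' ≤ 1 / g := one_div_le_one_div_of_le g0 hg
  have h8 : 3/2 / g = 3/2 * (1 / g) := by ring
  have h9 : 5/2 / g' = 5/2 * (1 / g') := by ring
  linarith

lemma len_ge_one {K : Set (EuclideanSpace ℝ (Fin n))} (hK : IsCompact K) (hc : Convex ℝ K)
    {w y} (hw : w ∈ K) (hy : y ∈ K) (hne : y ≠ w) : 1 ≤ len K w y := by
  have hsub : Icc (0:ℝ) 1 ⊆ {s : ℝ | w + s • (y - w) ∈ K} := by
    intro s hs
    have := hc hw hy (a := 1 - s) (b := s) (by linarith [hs.2]) hs.1 (by ring)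
    show w + s • (y - w) ∈ K
    convert this using 1; module
  obtain ⟨R, hR⟩ := hK.isBounded.exists_norm_le
  have hp : 0 < ‖y - w‖ := norm_pos_iff.2 (sub_ne_zero.2 hne)
  have hfin : volume {s : ℝ | w + s • (y - w) ∈ K} ≠ ⊤ := by
    refine ((measure_mono (t := Icc (-((R + ‖w‖) / ‖y - w‖)) ((R + ‖w‖) / ‖y - w‖)) ?_).trans_lt ?_).ne
    · intro s hs
      have h1 := hR _ hs
      have h2 : ‖s • (y - w)‖ ≤ R + ‖w‖ := by
        have := norm_sub_le (w + s • (y - w)) w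
        rw [add_sub_cancel_left] at this
        linarith
      rw [norm_smul, ← le_div_iff₀ hp] at h2
      exact abs_le.1 h2
    · simp
  have := ENNReal.toReal_mono hfin (measure_mono hsub)
  simpa [len] using this

lemma dist_pow (hn : 2 ≤ n) {y w : EuclideanSpace ℝ (Fin n)} (hi : |inner ℝ y w| ≤ 2 * ‖y‖ * ‖w‖ / √n)
    (hw : ‖w‖ ≤ ‖y‖ / (2 * √n)) : ‖y - w‖ ^ n ≤ 7/2 * ‖y‖ ^ n := by
  have hs : 0 < √(n:ℝ) := by positivity
  have hss : √(n:ℝ) * √n = n := Real.mul_self_sqrt (by positivity)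
  have n0 : (0:ℝ) < n := by positivity
  have h1 : ‖y - w‖ ^ 2 ≤ ‖y‖ ^ 2 * (1 + 9/4/n) := by
    rw [norm_sub_sq_real]
    have a1 : -(2 * inner ℝ y w) ≤ 2 * ‖y‖ ^ 2 / n := by
      calc -(2 * inner ℝ y w) ≤ 2 * |inner ℝ y w| := by linarith [neg_abs_le (inner ℝ y w)]
        _ ≤ 2 * (2 * ‖y‖ * ‖w‖ / √n) := by linarith
        _ ≤ 2 * (2 * ‖y‖ * (‖y‖ / (2 * √n)) / √n) := by gcongr
        _ = 2 * ‖y‖ ^ 2 / n := by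
            field_simp; rw [Real.sq_sqrt n0.le]
    have a2 : ‖w‖ ^ 2 ≤ ‖y‖ ^ 2 / (4 * n) := by
      calc ‖w‖ ^ 2 ≤ (‖y‖ / (2 * √n)) ^ 2 := by gcongr
        _ = ‖y‖ ^ 2 / (4 * n) := by
            rw [div_pow, mul_pow, Real.sq_sqrt n0.le]; norm_num
    have a3 : ‖y‖ ^ 2 * (1 + 9/4/n) = ‖y‖ ^ 2 + 2 * ‖y‖ ^ 2 / n + ‖y‖ ^ 2 / (4 * n) := by
      field_simp; ring
    linarith
  have h2 : (1 + 9/4/(n:ℝ)) ^ n ≤ Real.exp (9/4) := by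
    have := Real.add_one_le_exp (9/4/(n:ℝ))
    calc (1 + 9/4/(n:ℝ)) ^ n ≤ (Real.exp (9/4/n)) ^ n := by gcongr; linarith
      _ = Real.exp (9/4) := by rw [← Real.exp_nat_mul]; congr 1; field_simp
  have h3 : Real.exp (9/4) ≤ (7/2)^2 := by
    have e1 : Real.exp (9/4) ^ 4 = Real.exp 1 ^ 9 := by
      rw [← Real.exp_nat_mul, ← Real.exp_nat_mul]; norm_num
    have e2 : Real.exp 1 ^ 9 ≤ 3 ^ 9 := by
      gcongr; linarith [Real.exp_one_lt_d9]
    refine le_of_pow_le_pow_left₀ (n := 4) (by norm_num) (by norm_num) ?_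
    rw [e1]; exact e2.trans (by norm_num)
  refine le_of_sq_le_sq ?_ (by positivity)
  calc (‖y - w‖ ^ n) ^ 2 = (‖y - w‖ ^ 2) ^ n := by ring
    _ ≤ (‖y‖ ^ 2 * (1 + 9/4/n)) ^ n := by gcongr
    _ = (‖y‖ ^ n) ^ 2 * (1 + 9/4/n) ^ n := by rw [mul_pow]; ring
    _ ≤ (‖y‖ ^ n) ^ 2 * (7/2)^2 := by gcongr; exact h2.trans h3
    _ = _ := by ring

lemma D2_bound (hn : 2 ≤ n) (w : EuclideanSpace ℝ (Fin n)) :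
    volume {y : EuclideanSpace ℝ (Fin n) | y ∈ Metric.closedBall 0 1 ∧ 2 * ‖y‖ * ‖w‖ / √n < |inner ℝ y w|} ≤
      ENNReal.ofReal (1/4) * volume (Metric.closedBall (0 : EuclideanSpace ℝ (Fin n)) 1) := by
  set D := {y : EuclideanSpace ℝ (Fin n) | y ∈ Metric.closedBall 0 1 ∧ 2 * ‖y‖ * ‖w‖ / √n < |inner ℝ y w|} with hD
  by_cases hw : w = 0
  · have : D = ∅ := by ext y; simp [hD, hw]
    rw [this]; simp
  have hw0 : 0 < ‖w‖ := norm_pos_iff.2 hw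
  have hs : 0 < √(n:ℝ) := by positivity
  have n0 : (0:ℝ) < n := by positivity
  set e := ‖w‖⁻¹ • w with he
  have he1 : ‖e‖ = 1 := by rw [he, norm_smul, norm_inv, norm_norm, inv_mul_cancel₀ hw0.ne']
  set f : ℝ → ℝ := (Iic 1).indicator (fun r => (r ^ 2)⁻¹) with hf
  have hfm : Measurable f := Measurable.indicator (by fun_prop) measurableSet_Iic
  have hf0 : ∀ r, 0 ≤ f r := fun r => indicator_nonneg (fun _ _ => by positivity) _
  have hm := second_moment f hfm hf0 e he1
  have hDm : MeasurableSet D := (measurableSet_closedBall).inter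
    (measurableSet_lt (f := fun y : EuclideanSpace ℝ (Fin n) => 2 * ‖y‖ * ‖w‖ / √n) (g := fun y => |inner ℝ y w|) (by fun_prop) (by fun_prop))
  have h1 : ∫⁻ x : EuclideanSpace ℝ (Fin n), ENNReal.ofReal (‖x‖ ^ 2 * f ‖x‖) ≤ volume (Metric.closedBall (0 : EuclideanSpace ℝ (Fin n)) 1) := by
    rw [← lintegral_indicator_one measurableSet_closedBall]
    refine lintegral_mono fun x => ?_
    by_cases hx : x ∈ Metric.closedBall (0 : EuclideanSpace ℝ (Fin n)) 1
    · rw [indicator_of_mem hx, Pi.one_apply, ENNReal.ofReal_le_one]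
      have : f ‖x‖ = (‖x‖ ^ 2)⁻¹ := indicator_of_mem (by simpa using hx) _
      rw [this]
      exact mul_inv_le_one
    · have : f ‖x‖ = 0 := indicator_of_notMem (by simpa using hx) _
      simp [this]
  have h2 : ENNReal.ofReal (4 / n) * volume D ≤ ∫⁻ x : EuclideanSpace ℝ (Fin n), ENNReal.ofReal ((inner ℝ e x) ^ 2 * f ‖x‖) := by
    rw [← setLIntegral_const]
    refine le_trans (setLIntegral_mono' hDm fun x hx => ?_) (setLIntegral_le_lintegral D _)
    have : f ‖x‖ = (‖x‖ ^ 2)⁻¹ := indicator_of_mem (by simpa using hx.1) _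
    rw [this]
    refine ENNReal.ofReal_le_ofReal ?_
    have hx0 : 0 < ‖x‖ := by
      rw [norm_pos_iff]; rintro rfl
      simpa using hx.2
    rw [← div_eq_mul_inv, le_div_iff₀ (by positivity)]
    have h3 : 2 * ‖x‖ / √n < |inner ℝ e x| := by
      rw [he, inner_smul_left, real_inner_comm]
      simp only [conj_trivial]
      rw [abs_mul, abs_of_pos (by positivity : 0 < ‖w‖⁻¹), ← div_eq_inv_mul, lt_div_iff₀ hw0]
      refine lt_of_le_of_lt (le_of_eq ?_) hx.2
      ring
    rw [← sq_abs (inner ℝ e x)]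
    calc 4 / n * ‖x‖ ^ 2 = (2 * ‖x‖ / √n) ^ 2 := by
          rw [div_pow, Real.sq_sqrt n0.le]; ring
      _ ≤ _ := by gcongr
  have h4 : ENNReal.ofReal 4 * volume D ≤ volume (Metric.closedBall (0 : EuclideanSpace ℝ (Fin n)) 1) := by
    refine le_trans ?_ (hm.le.trans h1)
    refine le_trans (le_of_eq ?_) (mul_le_mul_right h2 _)
    rw [← mul_assoc, ← ENNReal.ofReal_natCast n, ← ENNReal.ofReal_mul n0.le]
    congr 2; field_simp
  calc volume D = ENNReal.ofReal (1/4) * (ENNReal.ofReal 4 * volume D) := by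
        rw [← mul_assoc, ← ENNReal.ofReal_mul (by norm_num)]; norm_num
    _ ≤ _ := by gcongr

lemma D1_bound (hn : 2 ≤ n) {K : Set (EuclideanSpace ℝ (Fin n))} (hK : IsCompact K) (hc : Convex ℝ K)
    (h0 : K ∈ 𝓝 (0 : EuclideanSpace ℝ (Fin n))) {t : ℝ} (ht : 0 < t) (hg : good K 0 t) :
    volume.real {y : EuclideanSpace ℝ (Fin n) | y ∈ Metric.closedBall 0 1 ∧ 2 * ‖y‖ < gauge K y * t} ≤
      1/3 * volume.real (Metric.closedBall (0 : EuclideanSpace ℝ (Fin n)) 1) := by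
  set B := Metric.closedBall (0 : EuclideanSpace ℝ (Fin n)) 1 with hB
  set D := {y : EuclideanSpace ℝ (Fin n) | y ∈ B ∧ 2 * ‖y‖ < gauge K y * t} with hD
  have Bt : volume B ≠ ⊤ := (isCompact_closedBall _ _).measure_ne_top
  have Dt : volume D ≠ ⊤ := ((measure_mono (fun x hx => hx.1)).trans_lt Bt.lt_top).ne
  have hsub : D ⊆ (1/2 : ℝ) • D ∪ (B \ sect K 0 t) := by
    intro y hy
    by_cases h : ‖y‖ ≤ 1/2
    · left
      refine ⟨(2:ℝ) • y, ⟨?_, ?_⟩, ?_⟩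
      · rw [hB, mem_closedBall_zero_iff, norm_smul]; norm_num; linarith
      · rw [gauge_smul_of_nonneg (by norm_num), norm_smul, smul_eq_mul]; norm_num
        linarith [hy.2]
      · simp [smul_smul]
    · right
      refine ⟨hy.1, fun h2 => ?_⟩
      have h3 := h2.2
      rw [zero_add, mem_iff_gauge hK hc h0, gauge_smul_of_nonneg ht.le, smul_eq_mul] at h3
      linarith [hy.2]
  have hss : sect K 0 t ⊆ B := fun x hx => hx.1
  have h1 : volume.real D ≤ volume.real ((1/2 : ℝ) • D) + volume.real (B \ sect K 0 t) := by
    refine (measureReal_mono hsub (measure_union_ne_top ?_ ?_)).trans (measureReal_union_le _ _)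
    · rw [Measure.addHaar_smul]; exact ENNReal.mul_ne_top (by simp) Dt
    · exact ((measure_mono sdiff_subset).trans_lt Bt.lt_top).ne
  have h2 : volume.real ((1/2 : ℝ) • D) ≤ 1/4 * volume.real D := by
    rw [Measure.real, Measure.addHaar_smul, ENNReal.toReal_mul, finrank_euclideanSpace, Fintype.card_fin,
      ENNReal.toReal_ofReal (abs_nonneg _), abs_of_nonneg (by positivity)]
    have : (1/2 : ℝ) ^ n ≤ (1/2) ^ 2 := pow_le_pow_of_le_one (by norm_num) (by norm_num) hn
    have h3 : 0 ≤ (volume D).toReal := ENNReal.toReal_nonneg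
    rw [Measure.real]
    nlinarith
  have h3 : volume.real (B \ sect K 0 t) = volume.real B - volume.real (sect K 0 t) :=
    measureReal_sdiff hss (sect_compact hK 0 t).measurableSet Bt
  have h4 : 3/4 * volume.real B ≤ volume.real (sect K 0 t) := by
    have := ENNReal.toReal_mono (sect_compact hK 0 t).measure_ne_top hg.1
    rwa [ENNReal.toReal_mul, ENNReal.toReal_ofReal (by norm_num)] at this
  linarith

lemma overlap0 (hn : 2 ≤ n) {K : Set (EuclideanSpace ℝ (Fin n))} (hK : IsCompact K) (hc : Convex ℝ K)
    {t : ℝ} (ht : 0 < t) (hg : good K 0 t) {w : EuclideanSpace ℝ (Fin n)} (hwt : ‖w‖ ≤ t / (8 * √n)) :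
    ∃ X ⊆ K, MeasurableSet X ∧ ENNReal.ofReal (5/48) ≤ ∫⁻ y in X, dens K 0 y ∧
      ∀ y ∈ X, ENNReal.ofReal (1/7) * dens K 0 y ≤ dens K w y := by
  have hs : 0 < √(n:ℝ) := by positivity
  have hs1 : 1 ≤ √(n:ℝ) := by rw [Real.one_le_sqrt]; exact_mod_cast (by omega : 1 ≤ n)
  have n0 : (0:ℝ) < n := by positivity
  have hKball : ∀ u : EuclideanSpace ℝ (Fin n), ‖u‖ ≤ t / √n → u ∈ K := by
    intro u hu
    have := hg.2 ((t / √n)⁻¹ • u) (by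
      rw [norm_smul, norm_inv, Real.norm_of_nonneg (by positivity), inv_mul_le_iff₀ (by positivity)]; linarith)
    rwa [zero_add, smul_smul, mul_inv_cancel₀ (by positivity), one_smul] at this
  have h0 : K ∈ 𝓝 (0 : EuclideanSpace ℝ (Fin n)) :=
    mem_of_superset (Metric.closedBall_mem_nhds 0 (show 0 < t / √n by positivity)) fun u hu => hKball u (by simpa using hu)
  have h8 : t / (8 * √n) = t / √n / 8 := by field_simp
  have hp : 0 < t / √n := by positivity
  have hw1 : (4:ℝ) • w ∈ K := hKball _ (by rw [norm_smul]; norm_num; linarith)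
  have hw2 : (-4:ℝ) • w ∈ K := hKball _ (by rw [norm_smul]; norm_num; linarith)
  have hwK : w ∈ K := hKball _ (by linarith)
  have hgc : Continuous (gauge K) := continuous_gauge hc h0
  set C := {y : EuclideanSpace ℝ (Fin n) | gauge K y ≤ gauge K (-y) ∧ gauge K y * t ≤ 2 * ‖y‖ ∧
    |inner ℝ y w| ≤ 2 * ‖y‖ * ‖w‖ / √n} with hC
  have hCm : MeasurableSet C := by
    have c1 : IsClosed {y : EuclideanSpace ℝ (Fin n) | gauge K y ≤ gauge K (-y)} := isClosed_le (by fun_prop) (by fun_prop)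
    have c2 : IsClosed {y : EuclideanSpace ℝ (Fin n) | gauge K y * t ≤ 2 * ‖y‖} := isClosed_le (by fun_prop) (by fun_prop)
    have c3 : IsClosed {y : EuclideanSpace ℝ (Fin n) | |inner ℝ y w| ≤ 2 * ‖y‖ * ‖w‖ / √n} := isClosed_le (by fun_prop) (by fun_prop)
    exact (c1.inter (c2.inter c3)).measurableSet
  have hCc : ∀ (r : ℝ), 0 < r → ∀ x, x ∈ C → r • x ∈ C := by
    rintro r hr x ⟨h1, h2, h3⟩
    refine ⟨?_, ?_, ?_⟩
    · rw [← smul_neg, gauge_smul_of_nonneg hr.le, gauge_smul_of_nonneg hr.le]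
      exact mul_le_mul_of_nonneg_left h1 hr.le
    · rw [gauge_smul_of_nonneg hr.le, norm_smul, Real.norm_of_nonneg hr.le, smul_eq_mul]
      have := mul_le_mul_of_nonneg_left h2 hr.le
      linarith
    · rw [inner_smul_left, norm_smul, Real.norm_of_nonneg hr.le, conj_trivial, abs_mul, abs_of_pos hr]
      have := mul_le_mul_of_nonneg_left h3 hr.le
      refine this.trans (le_of_eq ?_)
      ring
  set B := Metric.closedBall (0 : EuclideanSpace ℝ (Fin n)) 1 with hB
  have Bt : volume B ≠ ⊤ := (isCompact_closedBall _ _).measure_ne_top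
  have B0 : 0 < volume.real B := ENNReal.toReal_pos (Metric.measure_closedBall_pos _ _ one_pos).ne' Bt
  have hD1 := D1_bound hn hK hc h0 ht hg
  have hD2 := D2_bound hn w
  rw [← hB] at hD1 hD2
  set D1 := {y : EuclideanSpace ℝ (Fin n) | y ∈ B ∧ 2 * ‖y‖ < gauge K y * t} with hD1d
  set D2 := {y : EuclideanSpace ℝ (Fin n) | y ∈ B ∧ 2 * ‖y‖ * ‖w‖ / √n < |inner ℝ y w|} with hD2d
  have hD2' : volume.real D2 ≤ 1/4 * volume.real B := by
    have := ENNReal.toReal_mono (ENNReal.mul_ne_top (by simp) Bt) hD2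
    rwa [ENNReal.toReal_mul, ENNReal.toReal_ofReal (by norm_num)] at this
  have hcover : B ⊆ ((C ∩ B) ∪ -(C ∩ B)) ∪ (D1 ∪ D2) := by
    intro y hy
    by_cases h1 : y ∈ D1
    · exact Or.inr (Or.inl h1)
    by_cases h2 : y ∈ D2
    · exact Or.inr (Or.inr h2)
    have h1' : gauge K y * t ≤ 2 * ‖y‖ := by
      by_contra h; push Not at h; exact h1 ⟨hy, h⟩
    have h2' : |inner ℝ y w| ≤ 2 * ‖y‖ * ‖w‖ / √n := by
      by_contra h; push Not at h; exact h2 ⟨hy, h⟩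
    left
    rcases le_total (gauge K y) (gauge K (-y)) with h | h
    · exact Or.inl ⟨⟨h, h1', h2'⟩, hy⟩
    · right
      refine ⟨⟨?_, ?_, ?_⟩, ?_⟩
      · rwa [neg_neg]
      · rw [norm_neg]; nlinarith
      · rwa [norm_neg, inner_neg_left, abs_neg]
      · simpa [hB] using hy
  have hCB : 5/24 * volume.real B ≤ volume.real (C ∩ B) := by
    have f1 : volume (C ∩ B) ≠ ⊤ := ((measure_mono inter_subset_right).trans_lt Bt.lt_top).ne
    have f3 : volume D1 ≠ ⊤ := ((measure_mono (fun x hx => hx.1)).trans_lt Bt.lt_top).ne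
    have f4 : volume D2 ≠ ⊤ := ((measure_mono (fun x hx => hx.1)).trans_lt Bt.lt_top).ne
    have e2 : volume (-(C ∩ B)) = volume (C ∩ B) := Measure.measure_neg _ _
    have a1 := measureReal_mono hcover (μ := volume) (by
      refine measure_union_ne_top (measure_union_ne_top f1 (by rw [e2]; exact f1)) (measure_union_ne_top f3 f4))
    have a2 := measureReal_union_le (μ := volume) ((C ∩ B) ∪ -(C ∩ B)) (D1 ∪ D2)
    have a3 := measureReal_union_le (μ := volume) (C ∩ B) (-(C ∩ B))
    have a4 := measureReal_union_le (μ := volume) D1 D2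
    have a5 : volume.real (-(C ∩ B)) = volume.real (C ∩ B) := by rw [Measure.real, e2, Measure.real]
    linarith
  set X := C ∩ {y | 1/2 ≤ gauge K y ∧ gauge K y ≤ 1} with hX
  have hXm : MeasurableSet X := hCm.inter (hgc.measurable measurableSet_Icc)
  have hXne : ∀ y ∈ X, y ≠ 0 := by
    rintro y hy rfl
    have := hy.2.1
    rw [gauge_zero] at this
    norm_num at this
  refine ⟨X, fun y hy => (mem_iff_gauge hK hc h0 y).2 hy.2.2, hXm, ?_, ?_⟩
  · have hci := coneInt hn hCm hCc hgc.measurable (fun r hr x => by rw [gauge_smul_of_nonneg hr.le, smul_eq_mul]) (fun x hx => gpos hK h0 hx)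
    calc ENNReal.ofReal (5/48) ≤ ENNReal.ofReal (1 / (n * volume.real B)) * (ENNReal.ofReal (n / 2) * volume (C ∩ B)) := by
          have : volume (C ∩ B) = ENNReal.ofReal (volume.real (C ∩ B)) := by
            rw [Measure.real, ENNReal.ofReal_toReal ((measure_mono inter_subset_right).trans_lt Bt.lt_top).ne]
          rw [this, ← ENNReal.ofReal_mul (by positivity), ← ENNReal.ofReal_mul (by positivity)]
          refine ENNReal.ofReal_le_ofReal ?_
          calc (5/48 : ℝ) = 1 / (n * volume.real B) * (n / 2 * (5/24 * volume.real B)) := by field_simp; norm_num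
            _ ≤ _ := by gcongr
      _ ≤ ENNReal.ofReal (1 / (n * volume.real B)) * ∫⁻ y in X, ENNReal.ofReal (gauge K y / ‖y‖ ^ n) := by gcongr
      _ = ∫⁻ y in X, ENNReal.ofReal (1 / (n * volume.real B)) * ENNReal.ofReal (gauge K y / ‖y‖ ^ n) := by
          rw [lintegral_const_mul _ (by have := hgc.measurable; fun_prop)]
      _ ≤ _ := by
          refine setLIntegral_mono' hXm fun y hy => ?_
          have hy0 := hXne y hy
          have hyn : 0 < ‖y‖ := norm_pos_iff.2 hy0
          have g0 := gpos hK h0 hy0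
          have g0' := gpos hK h0 (neg_ne_zero.2 hy0)
          rw [← ENNReal.ofReal_mul (by positivity), dens, len0 hK hc h0 hy0, sub_zero]
          refine ENNReal.ofReal_le_ofReal ?_
          have h1 : 1 / gauge K (-y) ≤ 1 / gauge K y := one_div_le_one_div_of_le g0 hy.1.1
          calc 1 / (n * volume.real B) * (gauge K y / ‖y‖ ^ n) = 2 / (n * volume.real B) * ((1 / gauge K y + 1 / gauge K y) * ‖y‖ ^ n)⁻¹ := by
                field_simp; norm_num
            _ ≤ _ := by gcongr
  · intro y hy
    have hy0 := hXne y hy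
    have hyK : y ∈ K := (mem_iff_gauge hK hc h0 y).2 hy.2.2
    have hyn : 0 < ‖y‖ := norm_pos_iff.2 hy0
    have g0 := gpos hK h0 hy0
    have g0' := gpos hK h0 (neg_ne_zero.2 hy0)
    have ht4 : t ≤ 4 * ‖y‖ := by
      have := hy.1.2.1
      have h2 := hy.2.1
      nlinarith
    have hwy : ‖w‖ ≤ ‖y‖ / (2 * √n) := by
      refine hwt.trans ?_
      rw [div_le_div_iff₀ (by positivity) (by positivity)]
      nlinarith
    have hwy2 : ‖w‖ < ‖y‖ := by
      refine hwy.trans_lt ?_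
      rw [div_lt_iff₀ (by positivity)]
      nlinarith
    have hne : y ≠ w := by rintro rfl; exact lt_irrefl _ hwy2
    have l1 := len_ge_one hK hc hwK hyK hne
    have l2 := lenw hK hc h0 hw1 hw2 hy.2.1 hy.2.2 hy.1.1
    have l3 := dist_pow hn hy.1.2.2 hwy
    have hyw : 0 < ‖y - w‖ := norm_pos_iff.2 (sub_ne_zero.2 hne)
    rw [dens, dens, ← ENNReal.ofReal_mul (by norm_num), len0 hK hc h0 hy0, sub_zero]
    refine ENNReal.ofReal_le_ofReal ?_
    set L := 1 / gauge K y + 1 / gauge K (-y) with hL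
    have hL0 : 0 < L := by positivity
    calc 1 / 7 * (2 / (n * volume.real B) * (L * ‖y‖ ^ n)⁻¹) = 2 / (n * volume.real B) * ((2 * L) * (7/2 * ‖y‖ ^ n))⁻¹ := by
          field_simp
      _ ≤ _ := by gcongr

lemma overlap (hn : 2 ≤ n) {K : Set (EuclideanSpace ℝ (Fin n))} (hK : IsCompact K) (hc : Convex ℝ K)
    {t : ℝ} (ht : 0 < t) {u v : EuclideanSpace ℝ (Fin n)} (hg : good K u t) (hwt : ‖v - u‖ ≤ t / (8 * √n)) :
    ∃ X ⊆ K, MeasurableSet X ∧ ENNReal.ofReal (5/48) ≤ ∫⁻ y in X, dens K u y ∧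
      ∀ y ∈ X, ENNReal.ofReal (1/7) * dens K u y ≤ dens K v y := by
  set K' := (fun y => y + u) ⁻¹' K with hK'
  have hd : ∀ a b, dens K' a b = dens K (a + u) (b + u) := by
    intro a b
    unfold dens len
    simp only [hK', mem_preimage, add_sub_add_right_eq_sub, add_right_comm]
  obtain ⟨X, hXK, hXm, h1, h2⟩ := overlap0 hn (K := K')
    ((Homeomorph.addRight u).isCompact_preimage.2 hK) (hc.translate_preimage_left u) ht (w := v - u) (by
      unfold good sect at hg ⊢
      simpa [hK', add_comm] using hg) hwt
  refine ⟨(fun y => y - u) ⁻¹' X, fun y hy => by simpa [hK'] using hXK hy, (by fun_prop : Measurable fun y => y - u) hXm, ?_, ?_⟩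
  · refine h1.trans (le_of_eq ?_)
    have mp := measurePreserving_add_right (volume : Measure (EuclideanSpace ℝ (Fin n))) u
    have := mp.setLIntegral_comp_preimage_emb (measurableEmbedding_addRight u) (fun y => dens K u y) ((fun y => y - u) ⁻¹' X)
    rw [← this]
    have e : (fun y => y + u) ⁻¹' ((fun y => y - u) ⁻¹' X) = X := by ext; simp
    rw [e]
    simp [hd]
  · intro y hy
    have := h2 _ hy
    simpa [hd] using this

end overlap
end HR

end Part7

section Part8
open MeasureTheory Set Filter Topology
open scoped ENNReal Pointwise

namespace HR

section final
variable {n : ℕ}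

lemma measurePreserving_sub_left' (a : ℝ) :
    MeasurePreserving (MeasurableEquiv.subLeft a) (volume : Measure ℝ) volume :=
  Measure.measurePreserving_sub_left volume a

lemma len_symm (K : Set (EuclideanSpace ℝ (Fin n))) (u x) : len K u x = len K x u := by
  unfold len
  congr 1
  have h : {s : ℝ | x + s • (u - x) ∈ K} = (fun s : ℝ => 1 - s) ⁻¹' {s : ℝ | u + s • (x - u) ∈ K} := by
    ext s
    simp only [mem_preimage, mem_ofPred_eq]
    have : x + s • (u - x) = u + (1 - s) • (x - u) := by module
    rw [this]
  rw [h]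
  exact ((measurePreserving_sub_left' (1:ℝ)).measure_preimage_equiv _).symm

lemma dens_symm (K : Set (EuclideanSpace ℝ (Fin n))) (u x) : dens K u x = dens K x u := by
  unfold dens
  rw [len_symm, norm_sub_rev]

lemma dens_meas {K : Set (EuclideanSpace ℝ (Fin n))} (hK : IsCompact K) :
    Measurable (fun p : EuclideanSpace ℝ (Fin n) × EuclideanSpace ℝ (Fin n) => dens K p.1 p.2) := by
  have h : Measurable (fun p : EuclideanSpace ℝ (Fin n) × EuclideanSpace ℝ (Fin n) => len K p.1 p.2) := by
    have hm : MeasurableSet {q : (EuclideanSpace ℝ (Fin n) × EuclideanSpace ℝ (Fin n)) × ℝ |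
        q.1.1 + q.2 • (q.1.2 - q.1.1) ∈ K} := by
      have : Continuous (fun q : (EuclideanSpace ℝ (Fin n) × EuclideanSpace ℝ (Fin n)) × ℝ =>
        q.1.1 + q.2 • (q.1.2 - q.1.1)) := by fun_prop
      exact (hK.isClosed.preimage this).measurableSet
    exact (measurable_measure_prodMk_left (ν := (volume : Measure ℝ)) hm).ennreal_toReal
  unfold dens
  refine ENNReal.measurable_ofReal.comp ?_
  refine measurable_const.mul ?_
  refine (h.mul ?_).inv
  fun_prop

/-- ergodic flow -/
noncomputable def flow (K S : Set (EuclideanSpace ℝ (Fin n))) : ℝ≥0∞ :=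
  ∫⁻ u in S, ∫⁻ x in K \ S, dens K u x

lemma flow_symm {K : Set (EuclideanSpace ℝ (Fin n))} (hK : IsCompact K) {S} (hS : S ⊆ K) :
    flow K S = flow K (K \ S) := by
  unfold flow
  rw [lintegral_lintegral_swap (dens_meas hK).aemeasurable, sdiff_sdiff_eq_self hS]
  exact lintegral_congr fun y => lintegral_congr fun x => dens_symm K x y

lemma overlap_S (hn : 2 ≤ n) {K : Set (EuclideanSpace ℝ (Fin n))} (hK : IsCompact K) (hc : Convex ℝ K)
    {t : ℝ} (ht : 0 < t) {u v : EuclideanSpace ℝ (Fin n)} (hg : good K u t) (hwt : ‖v - u‖ ≤ t / (8 * √n))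
    {S : Set (EuclideanSpace ℝ (Fin n))} (hS : MeasurableSet S)
    (h1 : ∫⁻ x in S, dens K u x < ENNReal.ofReal (1/80)) :
    ENNReal.ofReal (1/80) ≤ ∫⁻ x in K \ S, dens K v x := by
  obtain ⟨X, hXK, hX, h5, h7⟩ := overlap hn hK hc ht hg hwt
  have h2 : ENNReal.ofReal (7/80) ≤ ∫⁻ x in X \ S, dens K u x := by
    by_contra hcon
    push Not at hcon
    have h3 : ∫⁻ x in X, dens K u x = (∫⁻ x in X ∩ S, dens K u x) + ∫⁻ x in X \ S, dens K u x :=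
      (lintegral_inter_add_sdiff (dens K u) X hS).symm
    have h4 : ∫⁻ x in X ∩ S, dens K u x ≤ ∫⁻ x in S, dens K u x := lintegral_mono_set inter_subset_right
    have h6 : ∫⁻ x in X, dens K u x < ENNReal.ofReal (1/80) + ENNReal.ofReal (7/80) := by
      rw [h3]; exact ENNReal.add_lt_add (h4.trans_lt h1) hcon
    rw [← ENNReal.ofReal_add (by norm_num) (by norm_num)] at h6
    have := h5.trans_lt h6
    rw [ENNReal.ofReal_lt_ofReal_iff (by norm_num)] at this
    norm_num at this
  calc ENNReal.ofReal (1/80) = ENNReal.ofReal (1/7) * ENNReal.ofReal (7/80) := by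
        rw [← ENNReal.ofReal_mul (by norm_num)]; norm_num
    _ ≤ ENNReal.ofReal (1/7) * ∫⁻ x in X \ S, dens K u x := mul_le_mul_right h2 _
    _ = ∫⁻ x in X \ S, ENNReal.ofReal (1/7) * dens K u x := by
        exact (lintegral_const_mul _ ((dens_meas hK).comp (measurable_prodMk_left (x := u)))).symm
    _ ≤ ∫⁻ x in X \ S, dens K v x := setLIntegral_mono' (hX.diff hS) (fun x hx => h7 x hx.1)
    _ ≤ _ := lintegral_mono_set (sdiff_subset_sdiff_left hXK)

lemma markov_set {f : EuclideanSpace ℝ (Fin n) → ℝ≥0∞} (hf : Measurable f) {S : Set (EuclideanSpace ℝ (Fin n))}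
    (hS : MeasurableSet S) (hq : ∫⁻ u in S, f u ≠ ⊤) :
    volume.real {u ∈ S | ENNReal.ofReal (1/80) ≤ f u} ≤ 80 * (∫⁻ u in S, f u).toReal := by
  have h := mul_meas_ge_le_lintegral (μ := volume.restrict S) hf (ENNReal.ofReal (1/80))
  rw [Measure.restrict_apply (measurableSet_le measurable_const hf)] at h
  have h2 := ENNReal.toReal_mono hq h
  rw [ENNReal.toReal_mul, ENNReal.toReal_ofReal (by norm_num)] at h2
  have h3 : {u ∈ S | ENNReal.ofReal (1/80) ≤ f u} = {u | ENNReal.ofReal (1/80) ≤ f u} ∩ S := by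
    ext; simp [and_comm]
  rw [h3, Measure.real]
  linarith

lemma half (hn : 2 ≤ n) {K : Set (EuclideanSpace ℝ (Fin n))} (hK : IsCompact K) (hc : Convex ℝ K)
    (hB : ∃ z, Metric.closedBall z 1 ⊆ K) {S : Set (EuclideanSpace ℝ (Fin n))}
    (hS : MeasurableSet S) (hSK : S ⊆ K) (h2 : 2 * volume.real S ≤ volume.real K)
    (hd : 1 ≤ Metric.diam K) (hVK : 0 < volume.real K)
    (hq : flow K S ≠ ⊤) :
    volume.real S * (1 / (2 ^ 24 * n * Metric.diam K)) ≤ (flow K S).toReal := by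
  set d := Metric.diam K with hdd
  set q := (flow K S).toReal with hqq
  have hq0 : 0 ≤ q := ENNReal.toReal_nonneg
  have hn' : (2:ℝ) ≤ n := by exact_mod_cast hn
  have hs : 0 < √(n:ℝ) := by positivity
  have hss : √(n:ℝ) * √n = n := Real.mul_self_sqrt (by positivity)
  have hd0 : 0 < d := by linarith
  have hKm := hK.measurableSet
  have hKt : volume K ≠ ⊤ := hK.measure_ne_top
  have hfin : ∀ {B : Set (EuclideanSpace ℝ (Fin n))}, B ⊆ K → volume B ≠ ⊤ := fun hB' =>
    ((measure_mono hB').trans_lt hKt.lt_top).ne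
  set f : EuclideanSpace ℝ (Fin n) → ℝ≥0∞ := fun u => ∫⁻ x in K \ S, dens K u x with hf
  set g : EuclideanSpace ℝ (Fin n) → ℝ≥0∞ := fun u => ∫⁻ x in S, dens K u x with hg
  have hfm : Measurable f := (dens_meas hK).lintegral_prod_right'
  have hgm : Measurable g := (dens_meas hK).lintegral_prod_right'
  set c0 := ENNReal.ofReal (1/80) with hc0
  set Sa := {u ∈ S | c0 ≤ f u} with hSa
  set Sb := {u ∈ K \ S | c0 ≤ g u} with hSb
  have hSam : MeasurableSet Sa := hS.inter (measurableSet_le measurable_const hfm)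
  have hSaK : Sa ⊆ K := fun u hu => hSK hu.1
  have hSbK : Sb ⊆ K := fun u hu => hu.1.1
  have ha : volume.real Sa ≤ 80 * q := markov_set hfm hS hq
  have hb : volume.real Sb ≤ 80 * q := by
    have e : ∫⁻ u in K \ S, g u = flow K S := by
      rw [flow_symm hK hSK, flow, sdiff_sdiff_eq_self hSK]
    have := markov_set hgm (hKm.diff hS) (by rw [e]; exact hq)
    rwa [e] at this
  set S1 := S \ Sa with hS1
  have hS1v : volume.real S1 = volume.real S - volume.real Sa :=
    measureReal_sdiff (fun u hu => hu.1) hSam (hfin hSK)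
  set S1' := S1 ∩ interior K with hS1'
  have hS1m : MeasurableSet S1' := (hS.diff hSam).inter isOpen_interior.measurableSet
  have hfr : volume.real (frontier K) = 0 := by
    rw [Measure.real, hc.addHaar_frontier volume]; rfl
  have hfrK : frontier K ⊆ K := hK.isClosed.frontier_subset
  have hS1'K : S1' ⊆ K := fun u hu => interior_subset hu.2
  have hS1'v : volume.real S1 ≤ volume.real S1' := by
    have : S1 ⊆ S1' ∪ frontier K := by
      intro u hu
      by_cases hi : u ∈ interior K
      · exact Or.inl ⟨hu, hi⟩
      · exact Or.inr ⟨subset_closure (hSK hu.1), hi⟩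
    have h3 := measureReal_mono (μ := volume) this (hfin (union_subset hS1'K hfrK))
    have h4 := measureReal_union_le (μ := volume) S1' (frontier K)
    linarith
  set σ : ℝ := 1 / (32 * √n) with hσ
  have hσ0 : 0 < σ := by positivity
  set T : ℝ := 1 / (8 * d * √n) with hT
  have hT0 : 0 < T := by positivity
  have hTσ : T * σ = 1 / (256 * (n * d)) := by
    rw [hT, hσ, div_mul_div_comm]
    congr 1
    · norm_num
    · calc 8 * d * √(n:ℝ) * (32 * √n) = 256 * (√(n:ℝ) * √n * d) := by ring
        _ = _ := by rw [hss]
  have hnd : 1 ≤ n * d := by nlinarith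
  have hTσ1 : T * σ ≤ 1 := by
    rw [hTσ, div_le_one (by positivity)]; linarith
  have hdeep := deep hn hK hc hB
  have hex : ∃ y ∈ K, σ ≤ sf K y := by
    by_contra hcon
    push Not at hcon
    have : {x ∈ K | 1 / (32 * √n) ≤ sf K x} = ∅ := by
      ext x
      simp only [mem_ofPred_eq, mem_empty_iff_false, iff_false, not_and, not_le]
      exact hcon x
    rw [this] at hdeep
    simp at hdeep
    linarith
  have key : ∀ ε > 0, T * σ / 12 * (volume.real S - 80 * q - ε) ≤ 160 * q + ε := by
    intro ε hε
    obtain ⟨A, hAS, hAc, hAε⟩ := hS1m.exists_isCompact_sdiff_lt (μ := volume) (hfin hS1'K)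
      (ε := ENNReal.ofReal ε) (by simpa using hε)
    have hAε' : volume.real (S1' \ A) ≤ ε := by
      have := ENNReal.toReal_mono ENNReal.ofReal_ne_top hAε.le
      rwa [ENNReal.toReal_ofReal hε.le] at this
    have hAv : volume.real S1' - ε ≤ volume.real A := by
      rw [measureReal_sdiff hAS hAc.measurableSet (hfin hS1'K)] at hAε'
      linarith
    have hAle : volume.real A ≤ volume.real S :=
      measureReal_mono (fun u hu => (hAS hu).1.1) (hfin hSK)
    have hiso := (isoData hn hK hc hAc (fun u hu => (hAS hu).2) hσ0 hex).iso hT0 hTσ1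
      (by linarith) hdeep
    have hsub : reach K A (sf K) σ T \ A ⊆ Sa ∪ Sb ∪ (S1' \ A) ∪ frontier K := by
      rintro w ⟨hw, hwA⟩
      have hwK : w ∈ K := (isoData hn hK hc hAc (fun u hu => (hAS hu).2) hσ0 hex).reach_sub T hw
      obtain ⟨x, hx, y, hy, -, θ, hθ0, -, hwe, hθ⟩ := hw
      have hxS := (hAS hx).1
      have hxK := hSK hxS.1
      by_cases hwS : w ∈ S
      · by_cases hwa : w ∈ Sa
        · exact Or.inl (Or.inl (Or.inl hwa))
        · by_cases hi : w ∈ interior K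
          · exact Or.inl (Or.inr ⟨⟨⟨hwS, hwa⟩, hi⟩, hwA⟩)
          · exact Or.inr ⟨subset_closure hwK, hi⟩
      · refine Or.inl (Or.inl (Or.inr ⟨⟨hwK, hwS⟩, ?_⟩))
        by_contra hgw
        push Not at hgw
        have hsw : 0 < sf K w := by
          rcases (sf_nonneg K w).eq_or_lt with h | h
          · rw [← h, mul_zero] at hθ
            have : θ = 0 := le_antisymm hθ hθ0
            rw [this] at hwe
            simp at hwe
            rw [hwe] at hwA
            exact absurd hx hwA
          · exact h
        have hdist : ‖x - w‖ ≤ sf K w / (8 * √n) := by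
          have e : x - w = θ • (x - y) := by rw [hwe]; module
          rw [e, norm_smul, Real.norm_of_nonneg hθ0, ← dist_eq_norm]
          have h3 := Metric.dist_le_diam_of_mem hK.isBounded hxK hy
          calc θ * dist x y ≤ (T * sf K w) * d := by gcongr
            _ = sf K w / (8 * √n) := by rw [hT]; field_simp
        have h4 := overlap_S hn hK hc hsw (sf_good hn hK hwK) hdist hS hgw
        exact hxS.2 ⟨hxS.1, h4⟩
    have h5 := measureReal_mono (μ := volume) hsub
      (hfin (union_subset (union_subset (union_subset hSaK hSbK) (sdiff_subset.trans hS1'K)) hfrK))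
    have h6 := measureReal_union_le (μ := volume) (Sa ∪ Sb ∪ (S1' \ A)) (frontier K)
    have h7 := measureReal_union_le (μ := volume) (Sa ∪ Sb) (S1' \ A)
    have h8 := measureReal_union_le (μ := volume) Sa Sb
    have h9 : T * σ / 12 * (volume.real S - 80 * q - ε) ≤ T * σ / 12 * volume.real A := by
      apply mul_le_mul_of_nonneg_left _ (by positivity)
      linarith
    linarith
  have key2 : T * σ / 12 * (volume.real S - 80 * q) ≤ 160 * q := by
    refine le_of_forall_pos_le_add fun ε hε => ?_
    have := key (ε / 2) (by positivity)
    nlinarith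
  rw [hTσ] at key2
  have e1 : 1 / (256 * (n * d)) / 12 * (volume.real S - 80 * q) = (volume.real S - 80 * q) / (3072 * (n * d)) := by
    rw [div_div, one_div_mul_eq_div]; congr 1; ring
  rw [e1, div_le_iff₀ (by positivity)] at key2
  rw [mul_one_div, div_le_iff₀ (by positivity)]
  nlinarith [mul_nonneg hq0 (sub_nonneg.2 hnd)]

lemma vn_eq (hn : 2 ≤ n) : volume.real (Metric.closedBall (0 : EuclideanSpace ℝ (Fin n)) 1) =
    Real.pi ^ ((n : ℝ) / 2) / Real.Gamma (1 + (n : ℝ) / 2) := by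
  have : Nonempty (Fin n) := ⟨⟨0, by omega⟩⟩
  have hG : 0 < Real.Gamma ((n : ℝ) / 2 + 1) := Real.Gamma_pos_of_pos (by positivity)
  rw [Measure.real, EuclideanSpace.volume_closedBall, Fintype.card_fin, ENNReal.ofReal_one, one_pow, one_mul,
    ENNReal.toReal_ofReal (by positivity), add_comm (1:ℝ)]
  congr 1
  rw [Real.sqrt_eq_rpow, ← Real.rpow_natCast, ← Real.rpow_mul Real.pi_pos.le]
  congr 1; ring

lemma main (hn : 2 ≤ n) {K : Set (EuclideanSpace ℝ (Fin n))} (hK : IsCompact K) (hc : Convex ℝ K)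
    (hB : ∃ z, Metric.closedBall z 1 ⊆ K) {S : Set (EuclideanSpace ℝ (Fin n))}
    (hS : MeasurableSet S) (hSK : S ⊆ K) (hd : 1 ≤ Metric.diam K) (hVK : 0 < volume.real K)
    (hq : flow K S ≠ ⊤) :
    min (volume.real S) (volume.real (K \ S)) * (1 / (2 ^ 24 * n * Metric.diam K)) ≤ (flow K S).toReal := by
  have hd' : volume.real (K \ S) = volume.real K - volume.real S := measureReal_sdiff hSK hS hK.measure_ne_top
  have hc0 : 0 ≤ 1 / (2 ^ 24 * n * Metric.diam K) := by positivity
  rcases le_total (2 * volume.real S) (volume.real K) with h | h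
  · exact (mul_le_mul_of_nonneg_right (min_le_left _ _) hc0).trans (half hn hK hc hB hS hSK h hd hVK hq)
  · refine (mul_le_mul_of_nonneg_right (min_le_right _ _) hc0).trans ?_
    have e := flow_symm hK hSK
    rw [e]
    exact half hn hK hc hB (hK.measurableSet.diff hS) sdiff_subset (by linarith) hd hVK (by rwa [← e])

end final

end HR

end Part8

open MeasureTheory ProbabilityTheory

/-- (Lovász–Vempala, conductance of hit-and-run.) Let `K ⊂ ℝⁿ` (`n ≥ 2`)
be a convex body containing a closed unit ball and of diameter `d`, and let `P` be the
hit-and-run kernel on `K` with stationary uniform distribution `π_K`. Then for every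
measurable `S ⊆ K` with `0 < π_K(S) < 1`, the conductance satisfies
`φ(S) ≥ 1/(2^24 n d)`. -/
theorem hit_and_run_conductance_uniform
    (n : ℕ) (hn : 2 ≤ n) (K : Set (EuclideanSpace ℝ (Fin n)))
    (hK_compact : IsCompact K) (hK_convex : Convex ℝ K)
    (hK_interior : (interior K).Nonempty)
    (hK_ball : ∃ z, Metric.closedBall z 1 ⊆ K)
    (d : ℝ) (hd : Metric.diam K = d)
    (chord : EuclideanSpace ℝ (Fin n) → EuclideanSpace ℝ (Fin n) → ℝ)
    (hchord : ∀ u x, chord u x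
      = ‖x - u‖ * (volume {t : ℝ | u + t • (x - u) ∈ K}).toReal)
    (vn : ℝ) (hvn : vn = Real.pi ^ ((n : ℝ) / 2) / Real.Gamma (1 + (n : ℝ) / 2))
    (P : Kernel (EuclideanSpace ℝ (Fin n)) (EuclideanSpace ℝ (Fin n))) [IsMarkovKernel P]
    (hP : ∀ u ∈ K, ∀ A : Set (EuclideanSpace ℝ (Fin n)), MeasurableSet A → A ⊆ K →
      P u A = ∫⁻ x in A,
        ENNReal.ofReal ((2 / (n * vn)) * (chord u x * ‖x - u‖ ^ (n - 1))⁻¹) ∂volume)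
    (πK : Measure (EuclideanSpace ℝ (Fin n)))
    (hπK : πK = (volume K)⁻¹ • volume.restrict K) :
    ∀ S : Set (EuclideanSpace ℝ (Fin n)), MeasurableSet S → S ⊆ K →
      0 < πK S → πK S < 1 →
      1 / (2 ^ 24 * n * d) ≤
        (∫⁻ u in S, P u (K \ S) ∂πK).toReal / min (πK S).toReal (πK (K \ S)).toReal := by
  intro S hS hSK h0 h1
  subst hd hvn
  have hdens : ∀ u ∈ K, P u (K \ S) = ∫⁻ x in K \ S, HR.dens K u x := by
    intro u hu
    rw [hP u hu _ (hK_compact.measurableSet.diff hS) Set.sdiff_subset]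
    refine lintegral_congr fun x => ?_
    unfold HR.dens HR.len
    rw [HR.vn_eq hn, hchord]
    congr 3
    obtain ⟨m, rfl⟩ : ∃ m, n = m + 1 := ⟨n - 1, by omega⟩
    rw [Nat.add_sub_cancel]
    ring
  have hflow : ∫⁻ u in S, P u (K \ S) = HR.flow K S :=
    setLIntegral_congr_fun hS (fun u hu => hdens u (hSK hu))
  have hKt : volume K ≠ ⊤ := hK_compact.measure_ne_top
  have hK0 : volume K ≠ 0 := (Measure.measure_pos_of_nonempty_interior _ hK_interior).ne'
  have hV : 0 < volume.real K := ENNReal.toReal_pos hK0 hKt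
  have hq : HR.flow K S ≠ ⊤ := by
    rw [← hflow]
    refine ((lintegral_mono (g := fun _ => 1) fun u => prob_le_one).trans_lt ?_).ne
    simp only [lintegral_const, one_mul, Measure.restrict_apply MeasurableSet.univ, Set.univ_inter]
    exact (measure_mono hSK).trans_lt hKt.lt_top
  have hdiam : 1 ≤ Metric.diam K := by
    obtain ⟨z, hz⟩ := hK_ball
    have : Nonempty (Fin n) := ⟨⟨0, by omega⟩⟩
    obtain ⟨v, hv⟩ := exists_norm_eq (EuclideanSpace ℝ (Fin n)) zero_le_one
    have h3 := Metric.dist_le_diam_of_mem hK_compact.isBounded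
      (hz (show z + v ∈ Metric.closedBall z 1 by simp [hv]))
      (hz (Metric.mem_closedBall_self zero_le_one))
    rwa [dist_self_add_left, hv] at h3
  have hπ : ∀ A ⊆ K, MeasurableSet A → πK A = (volume K)⁻¹ * volume A := by
    intro A hA hAm
    rw [hπK, Measure.smul_apply, Measure.restrict_apply hAm, Set.inter_eq_left.2 hA, smul_eq_mul]
  have hflowK : ∫⁻ u in S, P u (K \ S) ∂πK = (volume K)⁻¹ * HR.flow K S := by
    rw [hπK, Measure.restrict_smul, Measure.restrict_restrict hS, Set.inter_eq_left.2 hSK,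
      lintegral_smul_measure, hflow, smul_eq_mul]
  have hπd := hπ (K \ S) Set.sdiff_subset (hK_compact.measurableSet.diff hS)
  have hπS := hπ S hSK hS
  have hmain := HR.main hn hK_compact hK_convex hK_ball hS hSK hdiam hV hq
  have hS0 : 0 < volume.real S := by
    refine ENNReal.toReal_pos ?_ ((measure_mono hSK).trans_lt hKt.lt_top).ne
    intro h; rw [hπS, h, mul_zero] at h0; exact lt_irrefl _ h0
  have hS1 : 0 < volume.real (K \ S) := by
    rw [measureReal_sdiff hSK hS hKt, sub_pos]
    refine (ENNReal.toReal_lt_toReal ((measure_mono hSK).trans_lt hKt.lt_top).ne hKt).2 ?_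
    rw [hπS] at h1
    by_contra hcon
    push Not at hcon
    have h5 : (volume K)⁻¹ * volume K ≤ (volume K)⁻¹ * volume S := mul_le_mul_right hcon _
    rw [ENNReal.inv_mul_cancel hK0 hKt] at h5
    exact absurd h1 (not_lt.2 h5)
  rw [hflowK, hπd, hπS, ENNReal.toReal_mul, ENNReal.toReal_mul, ENNReal.toReal_mul]
  have hI : 0 < ((volume K)⁻¹).toReal := by rw [ENNReal.toReal_inv]; exact inv_pos.2 hV
  rw [← mul_min_of_nonneg _ _ hI.le, mul_div_mul_left _ _ hI.ne']
  refine (le_div_iff₀ (lt_min hS0 hS1)).2 ?_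
  rw [mul_comm]
  exact hmain
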